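/- arXiv:1211.0794 — 16 statements merged into one kernel-verified Lean document; each statement's English description precedes it below -/
import Mathlib

section
/- For every real y with −π/2 < y < π/2, the series Σ_{k=0}^∞ (−1)^k · cos((2k+1)·y)/(2k+1) converges and its sum equals π/4. -/
open Filter Topology

/-- Partial sums of the derivative of the odd cosine series, in closed form. -/
lemma two_mul_cos_mul_sum_sin_odd (x : ℝ) (N : ℕ) :
    2 * Real.cos x * ∑ k ∈ Finset.range N, (-1 : ℝ) ^ k * Real.sin ((2 * (k : ℝ) + 1) * x) =
      -((-1) ^ N * Real.sin (2 * N * x)) := by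
  induction N with
  | zero => simp
  | succ N ih =>
    rw [Finset.sum_range_succ, mul_add, ih]
    have h1 : 2 * ((N + 1 : ℕ) : ℝ) * x = (2 * N + 1) * x + x := by push_cast; ring
    have h2 : 2 * (N : ℝ) * x = (2 * N + 1) * x - x := by ring
    rw [h1, h2, Real.sin_add, Real.sin_sub, pow_succ]
    ring

/-- Adding the boundary term of an integration by parts to the partial sum of the odd cosine series
leaves a function whose derivative is `O(1 / N)`. -/
lemma hasDerivAt_sum_cos_odd_add {x : ℝ} (hx : Real.cos x ≠ 0) {N : ℕ} (hN : N ≠ 0) :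
    HasDerivAt (fun t : ℝ => (∑ k ∈ Finset.range N,
        (-1 : ℝ) ^ k * Real.cos ((2 * (k : ℝ) + 1) * t) / (2 * (k : ℝ) + 1)) +
        (-1) ^ N * Real.cos (2 * N * t) / (4 * N * Real.cos t))
      ((-1) ^ N * Real.cos (2 * N * x) * Real.sin x / (4 * N * Real.cos x ^ 2)) x := by
  have hN' : (N : ℝ) ≠ 0 := Nat.cast_ne_zero.mpr hN
  have hsum : HasDerivAt (fun t : ℝ => ∑ k ∈ Finset.range N,
      (-1 : ℝ) ^ k * Real.cos ((2 * (k : ℝ) + 1) * t) / (2 * (k : ℝ) + 1))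
      (∑ k ∈ Finset.range N, -((-1 : ℝ) ^ k * Real.sin ((2 * (k : ℝ) + 1) * x))) x := by
    refine HasDerivAt.fun_sum fun k _ => ?_
    have hk : 2 * (k : ℝ) + 1 ≠ 0 := by positivity
    refine (((((hasDerivAt_id' x).const_mul (2 * (k : ℝ) + 1)).cos).const_mul
      ((-1 : ℝ) ^ k)).div_const (2 * (k : ℝ) + 1)).congr_deriv ?_
    field_simp
  have hquot := ((((hasDerivAt_id' x).const_mul (2 * (N : ℝ))).cos).const_mul ((-1 : ℝ) ^ N)).div
    ((Real.hasDerivAt_cos x).const_mul (4 * (N : ℝ))) (by positivity)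
  have hclosed := two_mul_cos_mul_sum_sin_odd x N
  refine (hsum.add hquot).congr_deriv ?_
  rw [Finset.sum_neg_distrib, eq_div_of_mul_eq (by positivity) ((mul_comm _ _).trans hclosed)]
  field_simp
  ring

/-- Up to boundary terms, the partial sums of the odd cosine series at `y` and at `0` differ by
`O(1 / N)`. -/
lemma abs_sum_cos_odd_sub_le {y : ℝ} (h1 : -(Real.pi / 2) < y) (h2 : y < Real.pi / 2)
    {N : ℕ} (hN : N ≠ 0) :
    |((∑ k ∈ Finset.range N,
        (-1 : ℝ) ^ k * Real.cos ((2 * (k : ℝ) + 1) * y) / (2 * (k : ℝ) + 1)) +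
        (-1) ^ N * Real.cos (2 * N * y) / (4 * N * Real.cos y)) -
      ((∑ k ∈ Finset.range N, (-1 : ℝ) ^ k / (2 * (k : ℝ) + 1)) + (-1) ^ N / (4 * N))| ≤
      1 / (4 * N * Real.cos y ^ 2) * |y| := by
  have hcy : 0 < Real.cos y := Real.cos_pos_of_mem_Ioo ⟨h1, h2⟩
  have hN' : (0 : ℝ) < N := by positivity
  have hcos : ∀ x ∈ Set.uIcc 0 y, Real.cos y ≤ Real.cos x := by
    intro x hx
    rw [← Real.cos_abs y, ← Real.cos_abs x]
    refine Real.cos_le_cos_of_nonneg_of_le_pi (abs_nonneg _) ?_ ?_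
    · rw [abs_le]; constructor <;> linarith [Real.pi_pos]
    · simpa using Set.abs_sub_left_of_mem_uIcc hx
  have key := (convex_uIcc (0 : ℝ) y).norm_image_sub_le_of_norm_hasDerivWithin_le
    (C := 1 / (4 * N * Real.cos y ^ 2))
    (fun x hx => (hasDerivAt_sum_cos_odd_add
      (hcy.trans_le (hcos x hx)).ne' hN).hasDerivWithinAt) ?_ Set.left_mem_uIcc Set.right_mem_uIcc
  · simpa using key
  · intro x hx
    have hle := hcos x hx
    rw [Real.norm_eq_abs, abs_div, abs_mul, abs_mul, abs_pow, abs_neg, abs_one, one_pow, one_mul,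
      abs_of_pos (by have := hcy.trans_le hle; positivity : 0 < 4 * (N : ℝ) * Real.cos x ^ 2)]
    gcongr
    exact mul_le_one₀ (Real.abs_cos_le_one _) (abs_nonneg _) (Real.abs_sin_le_one _)

theorem stmt_1 (y : ℝ) (h1 : -(Real.pi / 2) < y) (h2 : y < Real.pi / 2) :
    Filter.Tendsto
      (fun N : ℕ => ∑ k ∈ Finset.range N,
        (-1 : ℝ) ^ k * Real.cos ((2 * (k : ℝ) + 1) * y) / (2 * (k : ℝ) + 1))
      Filter.atTop (nhds (Real.pi / 4)) := by
  have hcy : 0 < Real.cos y := Real.cos_pos_of_mem_Ioo ⟨h1, h2⟩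
  have hinv (c : ℝ) : Tendsto (fun N : ℕ => c * (N : ℝ)⁻¹) atTop (𝓝 0) := by
    simpa using (tendsto_inv_atTop_nhds_zero_nat (𝕜 := ℝ)).const_mul c
  have hdiff := squeeze_zero_norm'
    (f := fun N : ℕ => ((∑ k ∈ Finset.range N,
        (-1 : ℝ) ^ k * Real.cos ((2 * (k : ℝ) + 1) * y) / (2 * (k : ℝ) + 1)) +
        (-1) ^ N * Real.cos (2 * N * y) / (4 * N * Real.cos y)) -
      ((∑ k ∈ Finset.range N, (-1 : ℝ) ^ k / (2 * (k : ℝ) + 1)) + (-1) ^ N / (4 * N)))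
    (a := fun N : ℕ => |y| / (4 * Real.cos y ^ 2) * (N : ℝ)⁻¹)
    (by
      filter_upwards [eventually_ne_atTop 0] with N hN
      refine (abs_sum_cos_odd_sub_le h1 h2 hN).trans_eq ?_
      have hN' : (N : ℝ) ≠ 0 := Nat.cast_ne_zero.mpr hN
      field_simp) (hinv _)
  have hbdry (t : ℝ) : Tendsto
      (fun N : ℕ => (-1) ^ N * Real.cos (2 * N * t) / (4 * N * Real.cos t)) atTop (𝓝 0) := by
    refine squeeze_zero_norm (fun N => ?_) (hinv (1 / (4 * |Real.cos t|)))
    rw [Real.norm_eq_abs, abs_div, abs_mul, abs_mul, abs_mul, abs_pow, abs_neg, abs_one, one_pow,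
      one_mul, Nat.abs_cast, Nat.abs_ofNat]
    calc |Real.cos (2 * N * t)| / (4 * N * |Real.cos t|) ≤ 1 / (4 * N * |Real.cos t|) := by
          gcongr
          exact Real.abs_cos_le_one _
      _ = 1 / (4 * |Real.cos t|) * (N : ℝ)⁻¹ := by
          rw [mul_right_comm, ← div_div, div_eq_mul_inv _ (N : ℝ)]
  have h0 := hbdry 0
  simp only [mul_zero, Real.cos_zero, mul_one] at h0
  have hlim := ((hdiff.add Real.tendsto_sum_pi_div_four).add h0).sub (hbdry y)
  simp only [zero_add, add_zero, sub_zero] at hlim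
  refine hlim.congr fun N => ?_
  ring
end

section
/- For every real x with 0 < x < π, the series Σ_{k=0}^∞ sin((2k+1)·x)/(2k+1) converges and its sum equals π/4. -/
theorem sin_mul_sum_cos_odd_mul (N : ℕ) (t : ℝ) :
    2 * Real.sin t * ∑ k ∈ Finset.range N, Real.cos ((2 * (k : ℝ) + 1) * t) =
      Real.sin (2 * N * t) := by
  induction N with
  | zero => simp
  | succ n ih =>
    rw [Finset.sum_range_succ, mul_add, ih]
    have e1 : 2 * (n : ℝ) * t = (2 * (n : ℝ) + 1) * t - t := by ring
    have e2 : 2 * ((n + 1 : ℕ) : ℝ) * t = (2 * (n : ℝ) + 1) * t + t := by push_cast; ring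
    rw [e1, e2, Real.sin_sub, Real.sin_add]
    ring

theorem hasDerivAt_sum_sin_odd_mul_div (N : ℕ) (t : ℝ) :
    HasDerivAt
      (fun y : ℝ => ∑ k ∈ Finset.range N, Real.sin ((2 * (k : ℝ) + 1) * y) / (2 * (k : ℝ) + 1))
      (∑ k ∈ Finset.range N, Real.cos ((2 * (k : ℝ) + 1) * t)) t := by
  refine HasDerivAt.fun_sum fun k _ => ?_
  have hk : (2 * (k : ℝ) + 1) ≠ 0 := by positivity
  have h := (((hasDerivAt_id t).const_mul (2 * (k : ℝ) + 1)).sin).div_const (2 * (k : ℝ) + 1)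
  refine h.congr_deriv ?_
  simp only [id]
  field_simp

/-- Adding `cos (2 N y) / (4 N sin y)` to the partial sum cancels the leading oscillation of its
derivative. -/
theorem hasDerivAt_sum_sin_odd_mul_div_add {N : ℕ} (hN : N ≠ 0) {t : ℝ} (ht : Real.sin t ≠ 0) :
    HasDerivAt
      (fun y : ℝ => ∑ k ∈ Finset.range N, Real.sin ((2 * (k : ℝ) + 1) * y) / (2 * (k : ℝ) + 1) +
        Real.cos (2 * N * y) / (4 * N * Real.sin y))
      (-(Real.cos (2 * N * t) * Real.cos t) / (4 * N * Real.sin t ^ 2)) t := by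
  have hN' : (N : ℝ) ≠ 0 := Nat.cast_ne_zero.mpr hN
  have hc := ((hasDerivAt_id t).const_mul (2 * (N : ℝ))).cos
  have hs := (Real.hasDerivAt_sin t).const_mul (4 * (N : ℝ))
  have h := (hasDerivAt_sum_sin_odd_mul_div N t).add (hc.div hs (by positivity))
  refine h.congr_deriv ?_
  have hsum : ∑ k ∈ Finset.range N, Real.cos ((2 * (k : ℝ) + 1) * t) =
      Real.sin (2 * N * t) / (2 * Real.sin t) := by
    rw [← sin_mul_sum_cos_odd_mul, mul_div_cancel_left₀ _ (mul_ne_zero two_ne_zero ht)]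
  rw [hsum]
  simp only [id]
  field_simp
  ring

theorem sin_le_sin_of_mem_uIcc_pi_div_two {x t : ℝ} (h1 : 0 ≤ x) (h2 : x ≤ Real.pi)
    (ht : t ∈ Set.uIcc (Real.pi / 2) x) : Real.sin x ≤ Real.sin t := by
  have hpi := Real.pi_pos
  have h := strictConcaveOn_sin_Icc.concaveOn.ge_on_segment
    (show Real.pi / 2 ∈ Set.Icc 0 Real.pi from ⟨by linarith, by linarith⟩)
    (show x ∈ Set.Icc 0 Real.pi from ⟨h1, h2⟩) (by rwa [segment_eq_uIcc])
  rwa [Real.sin_pi_div_two, min_eq_right (Real.sin_le_one x)] at h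

theorem abs_sum_sin_odd_mul_div_sub_le {N : ℕ} (hN : N ≠ 0) {x : ℝ} (h1 : 0 < x)
    (h2 : x < Real.pi) :
    |∑ k ∈ Finset.range N, Real.sin ((2 * (k : ℝ) + 1) * x) / (2 * (k : ℝ) + 1) -
      ∑ k ∈ Finset.range N, Real.sin ((2 * (k : ℝ) + 1) * (Real.pi / 2)) / (2 * (k : ℝ) + 1)| ≤
      (|x - Real.pi / 2| / (4 * Real.sin x ^ 2) + 1 / (4 * Real.sin x) + 1 / 4) / N := by
  have hN' : (0 : ℝ) < N := by positivity
  have hsx := Real.sin_pos_of_pos_of_lt_pi h1 h2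
  have hle := fun t (ht : t ∈ Set.uIcc (Real.pi / 2) x) =>
    sin_le_sin_of_mem_uIcc_pi_div_two h1.le h2.le ht
  have hbound : ∀ t ∈ Set.uIcc (Real.pi / 2) x,
      ‖-(Real.cos (2 * N * t) * Real.cos t) / (4 * N * Real.sin t ^ 2)‖ ≤
        1 / (4 * N * Real.sin x ^ 2) := by
    intro t ht
    have hst := hle t ht
    rw [norm_div, norm_neg, norm_mul, Real.norm_eq_abs, Real.norm_eq_abs, Real.norm_eq_abs,
      abs_of_nonneg (by positivity : (0 : ℝ) ≤ 4 * N * Real.sin t ^ 2)]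
    gcongr
    exact mul_le_one₀ (Real.abs_cos_le_one _) (abs_nonneg _) (Real.abs_cos_le_one _)
  have hmv := (convex_uIcc (Real.pi / 2) x).norm_image_sub_le_of_norm_hasDerivWithin_le
    (fun t ht => (hasDerivAt_sum_sin_odd_mul_div_add hN
      (hsx.trans_le (hle t ht)).ne').hasDerivWithinAt) hbound Set.left_mem_uIcc Set.right_mem_uIcc
  have hcos : ∀ y : ℝ, 0 < Real.sin y →
      |Real.cos (2 * N * y) / (4 * N * Real.sin y)| ≤ 1 / (4 * N * Real.sin y) := by
    intro y hy
    rw [abs_div, abs_of_pos (by positivity : (0 : ℝ) < 4 * N * Real.sin y)]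
    gcongr
    exact Real.abs_cos_le_one _
  have hcx := hcos x hsx
  have hcp := hcos (Real.pi / 2) (by simp)
  have hrhs : (|x - Real.pi / 2| / (4 * Real.sin x ^ 2) + 1 / (4 * Real.sin x) + 1 / 4) / N =
      1 / (4 * N * Real.sin x ^ 2) * |x - Real.pi / 2| + 1 / (4 * N * Real.sin x) +
        1 / (4 * N * Real.sin (Real.pi / 2)) := by
    rw [Real.sin_pi_div_two]
    field_simp
  rw [hrhs]
  simp only [Real.norm_eq_abs] at hmv
  rw [abs_le] at hmv hcx hcp ⊢
  constructor <;> linarith [hmv.1, hmv.2, hcx.1, hcx.2, hcp.1, hcp.2]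

theorem tendsto_sum_sin_odd_mul_pi_div_two :
    Filter.Tendsto
      (fun N : ℕ => ∑ k ∈ Finset.range N,
        Real.sin ((2 * (k : ℝ) + 1) * (Real.pi / 2)) / (2 * (k : ℝ) + 1))
      Filter.atTop (nhds (Real.pi / 4)) := by
  refine Real.tendsto_sum_pi_div_four.congr fun N => Finset.sum_congr rfl fun k _ => ?_
  rw [show (2 * (k : ℝ) + 1) * (Real.pi / 2) = k * Real.pi + Real.pi / 2 by ring,
    Real.sin_add_pi_div_two, Real.cos_nat_mul_pi]

theorem stmt_2 (x : ℝ) (h1 : 0 < x) (h2 : x < Real.pi) :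
    Filter.Tendsto
      (fun N : ℕ => ∑ k ∈ Finset.range N,
        Real.sin ((2 * (k : ℝ) + 1) * x) / (2 * (k : ℝ) + 1))
      Filter.atTop (nhds (Real.pi / 4)) := by
  have hdiff := squeeze_zero_norm' (Filter.eventually_atTop.mpr ⟨1, fun N hN =>
    (Real.norm_eq_abs _).trans_le
      (abs_sum_sin_odd_mul_div_sub_le (Nat.one_le_iff_ne_zero.mp hN) h1 h2)⟩)
    (tendsto_const_div_atTop_nhds_zero_nat _)
  simpa using hdiff.add tendsto_sum_sin_odd_mul_pi_div_two
end

section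
/- For every real x with −π < x < π, the series Σ_{n=1}^∞ (−1)^{n+1} · sin(n x)/n converges and its sum equals x/2. -/
open Filter Finset Topology

/-- Dirichlet's test for `∑ wⁿ / n` on the unit circle, combined with Abel's limit theorem. -/
theorem tendsto_sum_pow_div_neg_log_one_sub {w : ℂ} (hw : ‖w‖ = 1) (hre : 0 < (1 - w).re) :
    Tendsto (fun N : ℕ => ∑ n ∈ range N, w ^ n / (n : ℂ)) atTop (𝓝 (-Complex.log (1 - w))) := by
  have hne : w ≠ 1 := by rintro rfl; simp at hre
  have hbound (n : ℕ) : ‖∑ i ∈ range n, w ^ (i + 1)‖ ≤ 2 / ‖w - 1‖ := by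
    have : ∑ i ∈ range n, w ^ (i + 1) = w * ((w ^ n - 1) / (w - 1)) := by
      rw [← geom_sum_eq hne, mul_sum]
      exact sum_congr rfl fun i _ => by ring
    rw [this, norm_mul, hw, one_mul, norm_div]
    gcongr
    calc ‖w ^ n - 1‖ ≤ ‖w ^ n‖ + ‖(1 : ℂ)‖ := norm_sub_le _ _
      _ = 2 := by rw [norm_pow, hw]; norm_num
  have hanti : Antitone fun n : ℕ => 1 / ((n : ℝ) + 1) := fun m n h => by
    dsimp only
    gcongr
  obtain ⟨l, hl⟩ := cauchySeq_tendsto_of_complete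
    (hanti.cauchySeq_series_mul_of_tendsto_zero_of_bounded
      tendsto_one_div_add_atTop_nhds_zero_nat hbound)
  have hsum : Tendsto (fun N : ℕ => ∑ n ∈ range N, w ^ n / (n : ℂ)) atTop (𝓝 l) := by
    rw [← tendsto_add_atTop_iff_nat 1]
    refine hl.congr fun N => ?_
    rw [sum_range_succ']
    simp [div_eq_inv_mul]
  have habel := tendsto_map'_iff.1 (Complex.tendsto_tsum_powerSeries_nhdsWithin_lt hsum)
  have hlog : Tendsto (fun r : ℝ => -Complex.log (1 - w * r)) (𝓝[<] 1)
      (𝓝 (-Complex.log (1 - w))) := by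
    have hcont : ContinuousAt (fun r : ℝ => -Complex.log (1 - w * r)) 1 := by
      refine (ContinuousAt.clog (by fun_prop) (Or.inl ?_)).neg
      simpa using hre
    simpa using hcont.tendsto.mono_left nhdsWithin_le_nhds
  have heq : ∀ᶠ r : ℝ in 𝓝[<] 1,
      ((fun z : ℂ => ∑' n : ℕ, w ^ n / (n : ℂ) * z ^ n) ∘ Complex.ofReal) r
        = -Complex.log (1 - w * r) := by
    filter_upwards [Ioo_mem_nhdsLT (zero_lt_one' ℝ)] with r hr
    have hlt : ‖w * r‖ < 1 := by
      simpa [hw, abs_of_pos hr.1] using hr.2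
    rw [← (Complex.hasSum_taylorSeries_neg_log hlt).tsum_eq]
    exact tsum_congr fun n => by rw [mul_pow]; ring
  rwa [← tendsto_nhds_unique (habel.congr' heq) hlog]

theorem Complex.one_add_exp_mul_I (x : ℝ) :
    1 + Complex.exp (x * I) = (2 * Real.cos (x / 2) : ℝ) * Complex.exp ((x / 2 : ℝ) * I) := by
  push_cast
  rw [Complex.two_cos, add_mul, ← Complex.exp_add, ← Complex.exp_add, add_comm]
  congr 2
  · ring
  · rw [← Complex.exp_zero]
    congr 1
    ring

theorem Complex.arg_one_add_exp_mul_I {x : ℝ} (h1 : -Real.pi < x) (h2 : x < Real.pi) :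
    (1 + Complex.exp (x * I)).arg = x / 2 := by
  have hcos : 0 < Real.cos (x / 2) := Real.cos_pos_of_mem_Ioo ⟨by linarith, by linarith⟩
  rw [Complex.one_add_exp_mul_I, Complex.arg_real_mul _ (by positivity), Complex.arg_exp_mul_I,
    toIocMod_eq_self]
  constructor <;> linarith

theorem stmt_3 (x : ℝ) (h1 : -Real.pi < x) (h2 : x < Real.pi) :
    Filter.Tendsto
      (fun N : ℕ => ∑ n ∈ Finset.Icc 1 N,
        (-1 : ℝ) ^ (n + 1) * Real.sin ((n : ℝ) * x) / (n : ℝ))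
      Filter.atTop (nhds (x / 2)) := by
  have hre : 0 < (1 - -Complex.exp (x * Complex.I)).re := by
    have hcos : 0 < Real.cos (x / 2) := Real.cos_pos_of_mem_Ioo ⟨by linarith, by linarith⟩
    rw [sub_neg_eq_add, Complex.one_add_exp_mul_I, Complex.re_ofReal_mul,
      Complex.exp_ofReal_mul_I_re]
    positivity
  have hlim := tendsto_sum_pow_div_neg_log_one_sub
    (by rw [norm_neg, Complex.norm_exp_ofReal_mul_I]) hre
  have him := ((Complex.continuous_im.tendsto _).comp hlim).neg
  rw [sub_neg_eq_add, Complex.neg_im, neg_neg, Complex.log_im,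
    Complex.arg_one_add_exp_mul_I h1 h2] at him
  refine ((tendsto_add_atTop_iff_nat 1).2 him).congr fun N => ?_
  have hterm (n : ℕ) : ((-Complex.exp (x * Complex.I)) ^ n / (n : ℂ)).im
      = -((-1 : ℝ) ^ (n + 1) * Real.sin ((n : ℝ) * x) / (n : ℝ)) := by
    have : (-Complex.exp (x * Complex.I)) ^ n
        = ((-1 : ℝ) ^ n : ℝ) * Complex.exp ((n * x : ℝ) * Complex.I) := by
      rw [neg_pow, ← Complex.exp_nat_mul]
      push_cast
      ring_nf
    rw [Complex.div_natCast_im, this, Complex.im_ofReal_mul, Complex.exp_ofReal_mul_I_im]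
    ring
  simp only [Function.comp_apply, Complex.im_sum, hterm, sum_neg_distrib, neg_neg]
  rw [range_eq_Ico, sum_eq_sum_Ico_succ_bot (Nat.succ_pos N)]
  simp [Finset.Ico_add_one_right_eq_Icc]
end

section
/- For every real x with 0 < x < π, the series Σ_{k=1}^∞ (k/(4k² − 1)) · sin(2k x) converges and its sum equals (π/8)·cos x; equivalently, cos x = (8/π) · Σ_{k=1}^∞ k·sin(2k x)/(4k² − 1) on (0, π). -/
open Finset in
/-- A trigonometric sum in closed form, by telescoping. -/
theorem two_mul_sin_mul_sum_cos_odd_mul (t : ℝ) (N : ℕ) :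
    2 * Real.sin t * ∑ j ∈ range N, Real.cos ((2 * j + 1) * t) = Real.sin (2 * N * t) := by
  induction N with
  | zero => simp
  | succ n ih =>
    have e₁ : 2 * ((n + 1 : ℕ) : ℝ) * t = (2 * n + 1) * t + t := by push_cast; ring
    have e₂ : 2 * (n : ℝ) * t = (2 * n + 1) * t - t := by ring
    rw [sum_range_succ, mul_add, ih, e₁, e₂, Real.sin_add, Real.sin_sub]
    ring

theorem Real.sin_odd_mul_pi_div_two (j : ℕ) :
    Real.sin ((2 * j + 1) * (Real.pi / 2)) = (-1) ^ j := by
  rw [show (2 * (j : ℝ) + 1) * (Real.pi / 2) = j * Real.pi + Real.pi / 2 by ring,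
    Real.sin_add_pi_div_two, Real.cos_nat_mul_pi]

/-- The derivative of a partial sum of the square wave, corrected by the boundary term of an
integration by parts. -/
theorem hasDerivAt_sum_sin_odd_mul_add {N : ℕ} (hN : N ≠ 0) {t : ℝ} (ht : Real.sin t ≠ 0) :
    HasDerivAt
      (fun t : ℝ => ∑ j ∈ Finset.range N, Real.sin ((2 * j + 1) * t) / (2 * j + 1) +
        Real.cos (2 * N * t) / (4 * N * Real.sin t))
      (-(Real.cos (2 * N * t) * Real.cos t) / (4 * N * Real.sin t ^ 2)) t := by
  have hN' : (N : ℝ) ≠ 0 := Nat.cast_ne_zero.mpr hN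
  have hsum : HasDerivAt
      (fun t : ℝ => ∑ j ∈ Finset.range N, Real.sin ((2 * j + 1) * t) / (2 * j + 1))
      (∑ j ∈ Finset.range N, Real.cos ((2 * j + 1) * t)) t := by
    refine HasDerivAt.fun_sum fun j _ => ?_
    have hj : (2 * (j : ℝ) + 1) ≠ 0 := by positivity
    refine ((((hasDerivAt_id' t).const_mul (2 * (j : ℝ) + 1)).sin).div_const
      (2 * (j : ℝ) + 1)).congr_deriv ?_
    rw [mul_one, mul_div_cancel_right₀ _ hj]
  have hcos := ((hasDerivAt_id' t).const_mul (2 * (N : ℝ))).cos.div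
    ((Real.hasDerivAt_sin t).const_mul (4 * (N : ℝ))) (by positivity)
  have hS : ∑ j ∈ Finset.range N, Real.cos ((2 * j + 1) * t) =
      Real.sin (2 * N * t) / (2 * Real.sin t) := by
    rw [← two_mul_sin_mul_sum_cos_odd_mul, mul_div_cancel_left₀ _ (by positivity)]
  refine (hsum.add hcos).congr_deriv ?_
  rw [hS]
  field_simp
  ring

open Filter Topology in
/-- The Fourier series of the square wave. -/
theorem tendsto_sum_sin_odd_mul_div {x : ℝ} (h1 : 0 < x) (h2 : x < Real.pi) :
    Tendsto (fun N : ℕ => ∑ j ∈ Finset.range N, Real.sin ((2 * j + 1) * x) / (2 * j + 1))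
      atTop (𝓝 (Real.pi / 4)) := by
  have hs : 0 < Real.sin x := Real.sin_pos_of_pos_of_lt_pi h1 h2
  have hconv := strictConcaveOn_sin_Icc.concaveOn.convex_ge (Real.sin x)
  let G (N : ℕ) (t : ℝ) : ℝ := ∑ j ∈ Finset.range N, Real.sin ((2 * j + 1) * t) / (2 * j + 1) +
    Real.cos (2 * N * t) / (4 * N * Real.sin t)
  have hinv (c : ℝ) : Tendsto (fun N : ℕ => c / (N : ℝ)) atTop (𝓝 0) :=
    tendsto_const_div_atTop_nhds_zero_nat c
  have hcorr {t : ℝ} (ht : 0 < Real.sin t) :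
      Tendsto (fun N : ℕ => Real.cos (2 * N * t) / (4 * N * Real.sin t)) atTop (𝓝 0) := by
    refine squeeze_zero_norm (fun N => ?_) (hinv (1 / (4 * Real.sin t)))
    rw [Real.norm_eq_abs, abs_div, abs_of_nonneg (by positivity : 0 ≤ 4 * (N : ℝ) * Real.sin t),
      div_div, mul_right_comm 4 (N : ℝ)]
    exact div_le_div_of_nonneg_right (Real.abs_cos_le_one _) (by positivity)
  have hdiff : Tendsto (fun N : ℕ => G N x - G N (Real.pi / 2)) atTop (𝓝 0) := by
    refine squeeze_zero_norm' ?_ (hinv (1 / (4 * Real.sin x ^ 2) * ‖x - Real.pi / 2‖))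
    filter_upwards [eventually_ne_atTop 0] with N hN
    have hN' : 0 < (N : ℝ) := by positivity
    have key := hconv.norm_image_sub_le_of_norm_hasDerivWithin_le (f := G N)
      (C := 1 / (4 * N * Real.sin x ^ 2)) (x := Real.pi / 2) (y := x)
      (fun t ht =>
        (hasDerivAt_sum_sin_odd_mul_add hN (hs.trans_le ht.2).ne').hasDerivWithinAt)
      (fun t ht => ?_) ⟨⟨by positivity, by linarith [Real.pi_pos]⟩, ?_⟩ ⟨⟨h1.le, h2.le⟩, le_rfl⟩
    · refine key.trans_eq ?_
      field_simp
    · have ht' : Real.sin x ≤ Real.sin t := ht.2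
      rw [Real.norm_eq_abs, abs_div, abs_neg, abs_mul,
        abs_of_nonneg (by positivity : 0 ≤ 4 * (N : ℝ) * Real.sin t ^ 2)]
      gcongr
      exact mul_le_one₀ (Real.abs_cos_le_one _) (abs_nonneg _) (Real.abs_cos_le_one _)
    · simpa using Real.sin_le_one x
  have hmid : Tendsto (fun N : ℕ => G N (Real.pi / 2)) atTop (𝓝 (Real.pi / 4 + 0)) := by
    refine Tendsto.add ?_ (hcorr (by simp))
    simpa only [Real.sin_odd_mul_pi_div_two] using Real.tendsto_sum_pi_div_four
  simpa [G] using (hdiff.add hmid).sub (hcorr hs)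

/-- Partial fractions and a shift of index reduce the series to the square wave. -/
theorem sum_div_mul_sin_two_mul_eq (x : ℝ) (N : ℕ) :
    ∑ k ∈ Finset.Icc 1 N, ((k : ℝ) / (4 * (k : ℝ) ^ 2 - 1)) * Real.sin (2 * (k : ℝ) * x) =
      Real.cos x / 2 * ∑ j ∈ Finset.range N, Real.sin ((2 * j + 1) * x) / (2 * j + 1) +
        Real.sin (2 * N * x) / 4 / (2 * N + 1) := by
  induction N with
  | zero => simp
  | succ n ih =>
    rw [Finset.sum_Icc_succ_top (by lia), ih, Finset.sum_range_succ]
    have e₁ : 2 * ((n + 1 : ℕ) : ℝ) * x = (2 * n + 1) * x + x := by push_cast; ring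
    have e₂ : 2 * (n : ℝ) * x = (2 * n + 1) * x - x := by ring
    have e₃ : 4 * ((n + 1 : ℕ) : ℝ) ^ 2 - 1 = (2 * n + 1) * (2 * n + 3) := by push_cast; ring
    have e₄ : 2 * ((n + 1 : ℕ) : ℝ) + 1 = 2 * n + 3 := by push_cast; ring
    rw [e₁, e₂, e₃, e₄, Real.sin_add, Real.sin_sub]
    generalize ∑ j ∈ Finset.range n, Real.sin ((2 * j + 1) * x) / (2 * j + 1) = S
    push_cast
    field_simp
    ring

theorem stmt_5 (x : ℝ) (h1 : 0 < x) (h2 : x < Real.pi) :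
    Filter.Tendsto
      (fun N : ℕ => ∑ k ∈ Finset.Icc 1 N,
        ((k : ℝ) / (4 * (k : ℝ) ^ 2 - 1)) * Real.sin (2 * (k : ℝ) * x))
      Filter.atTop (nhds (Real.pi / 8 * Real.cos x)) := by
  simp only [sum_div_mul_sin_two_mul_eq]
  have htail : Filter.Tendsto (fun N : ℕ => Real.sin (2 * N * x) / 4 / (2 * N + 1))
      Filter.atTop (nhds 0) := by
    refine squeeze_zero_norm (fun N => ?_) (tendsto_one_div_add_atTop_nhds_zero_nat (𝕜 := ℝ))
    rw [Real.norm_eq_abs, abs_div, abs_of_nonneg (by positivity : 0 ≤ 2 * (N : ℝ) + 1)]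
    gcongr
    · rw [abs_div, abs_of_pos (by norm_num : (0 : ℝ) < 4)]
      linarith [Real.abs_sin_le_one (2 * N * x)]
    · linarith [(Nat.cast_nonneg N : (0 : ℝ) ≤ N)]
  convert ((tendsto_sum_sin_odd_mul_div h1 h2).const_mul (Real.cos x / 2)).add htail using 2
  ring
end

section
/- For every real x with 0 ≤ x ≤ π, the series Σ_{k=1}^∞ cos(2k x)/(4k² − 1) converges absolutely and sin x = 2/π − (4/π) · Σ_{k=1}^∞ cos(2k x)/(4k² − 1). -/
lemma summable_one_div_four_mul_sq_sub_one :
    Summable (fun k : ℕ => 1 / (4 * ((k : ℝ) + 1) ^ 2 - 1)) := by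
  have h := (summable_nat_add_iff 1).2 (Real.summable_one_div_nat_pow.2 one_lt_two)
  refine Summable.of_nonneg_of_le (fun k => ?_) (fun k => ?_) h
  · have : (0 : ℝ) ≤ k := k.cast_nonneg
    exact div_nonneg zero_le_one (by nlinarith)
  · have : (0 : ℝ) ≤ k := k.cast_nonneg
    push_cast
    exact one_div_le_one_div_of_le (by positivity) (by nlinarith)

lemma four_mul_intCast_sq_sub_one_ne_zero (n : ℤ) : 4 * (n : ℂ) ^ 2 - 1 ≠ 0 := by
  have : 4 * n ^ 2 - 1 ≠ 0 := by omega
  exact_mod_cast this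

lemma fourierCoeffOn_sin (n : ℤ) :
    fourierCoeffOn Real.pi_pos (fun x => (Real.sin x : ℂ)) n =
      -2 / (Real.pi * (4 * (n : ℂ) ^ 2 - 1)) := by
  have hπ : (Real.pi : ℂ) ≠ 0 := by exact_mod_cast Real.pi_ne_zero
  have hn := four_mul_intCast_sq_sub_one_ne_zero n
  have hderiv : ∀ y : ℝ, HasDerivAt
      (fun y : ℝ => Complex.exp (-2 * Complex.I * n * y) *
        (2 * Complex.I * n * Complex.sin y + Complex.cos y) / (4 * (n : ℂ) ^ 2 - 1))
      (Complex.exp (-2 * Complex.I * n * y) * Complex.sin y) y := by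
    intro y
    have he : HasDerivAt (fun z : ℂ => Complex.exp (-2 * Complex.I * n * z))
        (Complex.exp (-2 * Complex.I * n * y) * (-2 * Complex.I * n * 1)) (y : ℂ) :=
      ((hasDerivAt_id (y : ℂ)).const_mul (-2 * Complex.I * n)).cexp
    have hs := ((Complex.hasDerivAt_sin y).const_mul (2 * Complex.I * n)).add
      (Complex.hasDerivAt_cos y)
    have h := ((he.mul hs).div_const (4 * (n : ℂ) ^ 2 - 1)).comp_ofReal
    refine h.congr_deriv ?_
    rw [div_eq_iff hn]
    simp only [Pi.add_apply]
    linear_combination (-4 * Complex.exp (-2 * Complex.I * n * y) * n ^ 2 * Complex.sin y) *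
      Complex.I_sq
  have hint := intervalIntegral.integral_eq_sub_of_hasDerivAt (a := 0) (b := Real.pi)
    (fun y _ => hderiv y) (Continuous.intervalIntegrable (by fun_prop) _ _)
  have hexp : Complex.exp (-2 * Complex.I * n * Real.pi) = 1 :=
    Complex.exp_eq_one_iff.2 ⟨-n, by push_cast; ring⟩
  rw [hexp] at hint
  rw [fourierCoeffOn_eq_integral]
  have hcongr : ∀ y : ℝ, fourier (-n) (y : AddCircle (Real.pi - 0)) • (Real.sin y : ℂ) =
      Complex.exp (-2 * Complex.I * n * y) * Complex.sin y := by
    intro y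
    rw [fourier_coe_apply, smul_eq_mul, Complex.ofReal_sin]
    congr 2
    push_cast
    rw [sub_zero]
    field_simp
  simp only [hcongr, hint, Complex.real_smul]
  push_cast
  simp only [Complex.sin_pi, Complex.cos_pi, Complex.sin_zero, Complex.cos_zero, mul_zero,
    Complex.exp_zero, sub_zero]
  field_simp
  ring

lemma summable_fourierCoeffOn_sin :
    Summable (fourierCoeffOn Real.pi_pos (fun x => (Real.sin x : ℂ))) := by
  have h : Summable (fun k : ℕ => -2 / (Real.pi * (4 * ((k : ℂ) + 1) ^ 2 - 1))) := by
    have h' := (summable_one_div_four_mul_sq_sub_one.mul_left (-2 / Real.pi))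
    refine (Complex.summable_ofReal.2 h').congr fun k => ?_
    push_cast
    rw [div_mul_div_comm, mul_one]
  refine Summable.of_add_one_of_neg_add_one (h.congr fun k => ?_) (h.congr fun k => ?_)
  · rw [fourierCoeffOn_sin]
    push_cast
    rfl
  · rw [fourierCoeffOn_sin]
    push_cast
    rw [neg_sq]

lemma hasSum_fourier_sin {x : ℝ} (h1 : 0 ≤ x) (h2 : x ≤ Real.pi) :
    HasSum (fun n : ℤ => -2 / (Real.pi * (4 * (n : ℂ) ^ 2 - 1)) *
      Complex.exp (2 * Complex.I * n * x)) (Real.sin x : ℂ) := by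
  have hπ : (Real.pi : ℂ) ≠ 0 := by exact_mod_cast Real.pi_ne_zero
  have : Fact (0 < Real.pi) := ⟨Real.pi_pos⟩
  let f : C(AddCircle Real.pi, ℂ) :=
    ⟨AddCircle.liftIco Real.pi 0 (fun x => (Real.sin x : ℂ)),
      AddCircle.liftIco_zero_continuous (by simp) (by fun_prop)⟩
  have hcoeff : ∀ n, fourierCoeff f n =
      fourierCoeffOn Real.pi_pos (fun x => (Real.sin x : ℂ)) n := by
    intro n
    refine (fourierCoeff_liftIco_eq _ n).trans ?_
    simp only [zero_add]
  have hs : Summable (fourierCoeff f) := summable_fourierCoeffOn_sin.congr fun n => (hcoeff n).symm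
  have hf : f (x : AddCircle Real.pi) = Real.sin x := by
    rcases h2.eq_or_lt with rfl | h2
    · rw [AddCircle.coe_period, ← QuotientAddGroup.mk_zero]
      refine (AddCircle.liftIco_zero_coe_apply (f := fun x => (Real.sin x : ℂ)) ⟨le_rfl, Real.pi_pos⟩).trans ?_
      simp
    · exact AddCircle.liftIco_zero_coe_apply (f := fun x => (Real.sin x : ℂ)) ⟨h1, h2⟩
  rw [← hf]
  refine (has_pointwise_sum_fourier_series_of_summable hs x).congr_fun fun n => ?_
  rw [hcoeff, fourierCoeffOn_sin, fourier_coe_apply, smul_eq_mul]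
  congr 2
  field_simp

lemma hasSum_cos_div_four_mul_sq_sub_one {x : ℝ} (h1 : 0 ≤ x) (h2 : x ≤ Real.pi) :
    HasSum (fun k : ℕ => Real.cos (2 * ((k : ℝ) + 1) * x) / (4 * ((k : ℝ) + 1) ^ 2 - 1))
      (1 / 2 - Real.pi / 4 * Real.sin x) := by
  have hπ : (Real.pi : ℂ) ≠ 0 := by exact_mod_cast Real.pi_ne_zero
  have h := ((hasSum_nat_add_iff' 1).2 (hasSum_fourier_sin h1 h2).nat_add_neg).mul_left
    (-Real.pi / 4 : ℂ)
  rw [← Complex.hasSum_ofReal]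
  convert! h using 1
  · funext k
    have hk := four_mul_intCast_sq_sub_one_ne_zero (k + 1)
    push_cast at hk ⊢
    rw [Complex.cos, neg_sq]
    field_simp
    ring_nf
  · simp
    field_simp
    ring

theorem stmt_6 (x : ℝ) (h1 : 0 ≤ x) (h2 : x ≤ Real.pi) :
    Summable (fun k : ℕ =>
      |Real.cos (2 * ((k : ℝ) + 1) * x) / (4 * ((k : ℝ) + 1) ^ 2 - 1)|) ∧
    Real.sin x = 2 / Real.pi -
      (4 / Real.pi) *
        ∑' k : ℕ, Real.cos (2 * ((k : ℝ) + 1) * x) / (4 * ((k : ℝ) + 1) ^ 2 - 1) := by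
  have h := hasSum_cos_div_four_mul_sq_sub_one h1 h2
  refine ⟨h.summable.abs, ?_⟩
  rw [h.tsum_eq]
  field_simp
  ring
end

section
/- For every real x with 0 ≤ x ≤ π, the series Σ_{k=0}^∞ cos((2k+1) x)/(2k+1)² converges absolutely and x = π/2 − (4/π) · Σ_{k=0}^∞ cos((2k+1) x)/(2k+1)². -/
/-- The Fourier cosine series of the second Bernoulli polynomial, rescaled to `[0, 2π]`. -/
theorem hasSum_cos_nat_mul_div_sq {y : ℝ} (h0 : 0 ≤ y) (h1 : y ≤ 2 * Real.pi) :
    HasSum (fun n : ℕ => Real.cos ((n : ℝ) * y) / (n : ℝ) ^ 2)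
      (Real.pi ^ 2 / 6 - Real.pi * y / 2 + y ^ 2 / 4) := by
  have hpi : (0 : ℝ) < 2 * Real.pi := by positivity
  have hy : y / (2 * Real.pi) ∈ Set.Icc (0 : ℝ) 1 :=
    ⟨by positivity, (div_le_one hpi).2 h1⟩
  have h := hasSum_one_div_nat_pow_mul_cos one_ne_zero hy
  have hB := bernoulliFun_two (y / (2 * Real.pi))
  rw [bernoulliFun] at hB
  rw [mul_one, hB] at h
  convert h using 1
  · ext n
    rw [show 2 * Real.pi * n * (y / (2 * Real.pi)) = n * y by field_simp]
    ring
  · norm_num [Nat.factorial]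
    field_simp
    ring

theorem hasSum_cos_odd_mul_div_sq {x : ℝ} (h0 : 0 ≤ x) (h1 : x ≤ Real.pi) :
    HasSum (fun k : ℕ => Real.cos ((2 * (k : ℝ) + 1) * x) / (2 * (k : ℝ) + 1) ^ 2)
      (Real.pi ^ 2 / 8 - Real.pi * x / 4) := by
  have hall := hasSum_cos_nat_mul_div_sq h0 (by linarith [Real.pi_pos])
  have heven : HasSum (fun k : ℕ => Real.cos (((2 * k : ℕ) : ℝ) * x) / ((2 * k : ℕ) : ℝ) ^ 2)
      ((Real.pi ^ 2 / 6 - Real.pi * (2 * x) / 2 + (2 * x) ^ 2 / 4) / 4) := by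
    refine ((hasSum_cos_nat_mul_div_sq (y := 2 * x) (by linarith) (by linarith)).div_const
      4).congr_fun fun k => ?_
    push_cast
    rw [show 2 * (k : ℝ) * x = k * (2 * x) by ring, mul_pow, div_div]
    ring
  have hodd : Summable
      (fun k : ℕ => Real.cos (((2 * k + 1 : ℕ) : ℝ) * x) / ((2 * k + 1 : ℕ) : ℝ) ^ 2) :=
    hall.summable.comp_injective (i := fun k : ℕ => 2 * k + 1) fun a b h => by
      simpa using h
  have hsum := (heven.even_add_odd
    (f := fun n : ℕ => Real.cos ((n : ℝ) * x) / (n : ℝ) ^ 2) hodd.hasSum).unique hall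
  convert hodd.hasSum using 1
  · ext k
    push_cast
    rfl
  · linarith

theorem stmt_7 (x : ℝ) (h1 : 0 ≤ x) (h2 : x ≤ Real.pi) :
    Summable (fun k : ℕ =>
      |Real.cos ((2 * (k : ℝ) + 1) * x) / (2 * (k : ℝ) + 1) ^ 2|) ∧
    x = Real.pi / 2 -
      (4 / Real.pi) *
        ∑' k : ℕ, Real.cos ((2 * (k : ℝ) + 1) * x) / (2 * (k : ℝ) + 1) ^ 2 := by
  have h := hasSum_cos_odd_mul_div_sq h1 h2
  refine ⟨h.summable.abs, ?_⟩
  rw [h.tsum_eq]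
  field_simp
  ring
end

section
/- Let 0 < α < π. Then the series Σ_{n=1}^∞ ((1 − cos(n α))/n) · sin(n x) converges to π/2 for every x with 0 < x < α, and converges to 0 for every x with α < x < π. -/
open Filter Topology Finset in
/-- The logarithmic series converges on the unit circle away from `1`. -/
theorem tendsto_sum_pow_succ_div_neg_log {w : ℂ} (hw : ‖w‖ = 1) (hw1 : w ≠ 1) :
    Tendsto (fun N : ℕ => ∑ n ∈ range N, w ^ (n + 1) / ((n : ℂ) + 1)) atTop
      (𝓝 (-Complex.log (1 - w))) := by
  have hbound (N : ℕ) : ‖∑ i ∈ range N, w ^ (i + 1)‖ ≤ 2 / ‖w - 1‖ := by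
    simp_rw [pow_succ]
    rw [← Finset.sum_mul, geom_sum_eq hw1, norm_mul, hw, mul_one, norm_div]
    gcongr
    refine (norm_sub_le _ _).trans ?_
    rw [norm_pow, hw]
    norm_num
  have hanti : Antitone fun n : ℕ => 1 / ((n : ℝ) + 1) := fun _ _ h =>
    Nat.one_div_le_one_div h
  obtain ⟨l, hl⟩ := cauchySeq_tendsto_of_complete
    (hanti.cauchySeq_series_mul_of_tendsto_zero_of_bounded
      tendsto_one_div_add_atTop_nhds_zero_nat hbound)
  replace hl : Tendsto (fun N : ℕ => ∑ n ∈ range N, w ^ (n + 1) / ((n : ℂ) + 1)) atTop (𝓝 l) := by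
    refine hl.congr fun N => Finset.sum_congr rfl fun n _ => ?_
    rw [Complex.real_smul]
    push_cast
    ring
  have habel := Complex.tendsto_tsum_powerSeries_nhdsWithin_lt hl
  rw [tendsto_map'_iff] at habel
  have hre : w.re < 1 := by
    refine lt_of_le_of_ne (hw ▸ Complex.re_le_norm w) fun h => hw1 ?_
    have hsq := Complex.sq_norm w
    rw [hw, Complex.normSq_apply, h] at hsq
    exact Complex.ext h (by simpa using hsq)
  have hslit : 1 - ((1 : ℝ) : ℂ) * w ∈ Complex.slitPlane := Or.inl (by simpa using hre)
  have hcont : ContinuousAt (fun r : ℝ => -Complex.log (1 - (r : ℂ) * w) / r) 1 := by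
    refine ContinuousAt.div (ContinuousAt.neg (ContinuousAt.clog ?_ hslit)) ?_ (by simp) <;>
      fun_prop
  have hlim : Tendsto (fun r : ℝ => -Complex.log (1 - (r : ℂ) * w) / r) (𝓝[<] 1)
      (𝓝 (-Complex.log (1 - w))) := by
    simpa using hcont.tendsto.mono_left nhdsWithin_le_nhds
  suffices h : l = -Complex.log (1 - w) from h ▸ hl
  refine tendsto_nhds_unique (habel.congr' ?_) hlim
  filter_upwards [Ioo_mem_nhdsLT (zero_lt_one' ℝ)] with r hr
  have hr0 : (r : ℂ) ≠ 0 := by exact_mod_cast hr.1.ne'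
  have hnorm : ‖(r : ℂ) * w‖ < 1 := by
    rw [norm_mul, hw, mul_one, Complex.norm_real, Real.norm_of_nonneg hr.1.le]
    exact hr.2
  rw [← ((Complex.hasSum_taylorSeries_neg_log' hnorm).div_const (r : ℂ)).tsum_eq]
  refine tsum_congr fun n => ?_
  field_simp
  ring

/-- The argument of `1 - exp (iy)` on `(0, 2π)`. -/
theorem arg_one_sub_exp_mul_I {y : ℝ} (hy0 : 0 < y) (hy : y < 2 * Real.pi) :
    Complex.arg (1 - Complex.exp (y * Complex.I)) = (y - Real.pi) / 2 := by
  have hs : 0 < 2 * Real.sin (y / 2) :=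
    mul_pos two_pos (Real.sin_pos_of_pos_of_lt_pi (by linarith) (by linarith))
  rw [← Complex.arg_mul_cos_add_sin_mul_I hs (θ := (y - Real.pi) / 2)
    ⟨by linarith [Real.pi_pos], by linarith⟩]
  congr 1
  have hcos : Real.cos ((y - Real.pi) / 2) = Real.sin (y / 2) := by
    rw [sub_div, Real.cos_sub_pi_div_two]
  have hsin : Real.sin ((y - Real.pi) / 2) = -Real.cos (y / 2) := by
    rw [sub_div, Real.sin_sub_pi_div_two]
  have hcos2 : Real.cos y = 1 - 2 * Real.sin (y / 2) ^ 2 := by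
    rw [Real.sin_sq_eq_half_sub, mul_div_cancel₀ y two_ne_zero]
    ring
  have hsin2 : Real.sin y = 2 * Real.sin (y / 2) * Real.cos (y / 2) := by
    rw [← Real.sin_two_mul, mul_div_cancel₀ y two_ne_zero]
  rw [Complex.exp_mul_I, ← Complex.ofReal_cos, ← Complex.ofReal_sin, ← Complex.ofReal_cos,
    ← Complex.ofReal_sin, hcos, hsin, hcos2, hsin2]
  simp only [Complex.ofReal_sub, Complex.ofReal_mul, Complex.ofReal_pow, Complex.ofReal_neg,
    Complex.ofReal_one, Complex.ofReal_ofNat]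
  ring

open Filter Topology Finset in
/-- The sawtooth Fourier series. -/
theorem tendsto_sum_sin_div {y : ℝ} (hy0 : 0 < y) (hy : y < 2 * Real.pi) :
    Tendsto (fun N : ℕ => ∑ n ∈ Icc 1 N, Real.sin ((n : ℝ) * y) / (n : ℝ)) atTop
      (𝓝 ((Real.pi - y) / 2)) := by
  have hne : Complex.exp (y * Complex.I) ≠ 1 := fun h => by
    have hcos : Real.cos y = 1 := by
      rw [← Complex.exp_ofReal_mul_I_re, h, Complex.one_re]
    rw [Real.cos_eq_one_iff_of_lt_of_lt (by linarith) hy] at hcos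
    exact hy0.ne' hcos
  have h := (Complex.continuous_im.tendsto _).comp
    (tendsto_sum_pow_succ_div_neg_log (Complex.norm_exp_ofReal_mul_I y) hne)
  rw [Complex.neg_im, Complex.log_im, arg_one_sub_exp_mul_I hy0 hy, ← neg_div, neg_sub] at h
  refine h.congr fun N => ?_
  rw [Function.comp_apply, Complex.im_sum, ← Finset.Ico_add_one_right_eq_Icc,
    Finset.sum_Ico_eq_sum_range, Nat.add_sub_cancel]
  refine Finset.sum_congr rfl fun n _ => ?_
  have hexp : Complex.exp (y * Complex.I) ^ (n + 1)
      = Complex.exp ((((n + 1 : ℕ) : ℝ) * y : ℝ) * Complex.I) := by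
    rw [← Complex.exp_nat_mul]
    push_cast
    ring_nf
  have hden : (n : ℂ) + 1 = (((n + 1 : ℕ) : ℝ) : ℂ) := by push_cast; rfl
  rw [hexp, hden, Complex.div_ofReal_im, Complex.exp_ofReal_mul_I_im, add_comm 1 n]

theorem one_sub_cos_div_mul_sin (k a x : ℝ) :
    (1 - Real.cos (k * a)) / k * Real.sin (k * x) =
      Real.sin (k * x) / k -
        (Real.sin (k * (x + a)) / k + Real.sin (k * (x - a)) / k) / 2 := by
  rw [mul_add, mul_sub, Real.sin_add, Real.sin_sub]
  ring


theorem stmt_8 (α : ℝ) (hα1 : 0 < α) (hα2 : α < Real.pi) :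
    (∀ x : ℝ, 0 < x → x < α →
      Filter.Tendsto
        (fun N : ℕ => ∑ n ∈ Finset.Icc 1 N,
          ((1 - Real.cos ((n : ℝ) * α)) / (n : ℝ)) * Real.sin ((n : ℝ) * x))
        Filter.atTop (nhds (Real.pi / 2))) ∧
    (∀ x : ℝ, α < x → x < Real.pi →
      Filter.Tendsto
        (fun N : ℕ => ∑ n ∈ Finset.Icc 1 N,
          ((1 - Real.cos ((n : ℝ) * α)) / (n : ℝ)) * Real.sin ((n : ℝ) * x))
        Filter.atTop (nhds 0)) := by
  simp_rw [one_sub_cos_div_mul_sin, Finset.sum_sub_distrib, ← Finset.sum_div,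
    Finset.sum_add_distrib]
  refine ⟨fun x hx0 hxα => ?_, fun x hαx hxπ => ?_⟩
  · have hdiff := (tendsto_sum_sin_div (y := α - x) (by linarith) (by linarith)).neg
    simp_rw [← Finset.sum_neg_distrib, ← neg_div, ← Real.sin_neg, ← mul_neg, neg_sub] at hdiff
    convert (tendsto_sum_sin_div hx0 (by linarith)).sub
      (((tendsto_sum_sin_div (y := x + α) (by linarith) (by linarith)).add hdiff).div_const 2)
      using 2
    ring
  · convert (tendsto_sum_sin_div (y := x) (by linarith) (by linarith)).sub
      (((tendsto_sum_sin_div (y := x + α) (by linarith) (by linarith)).add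
        (tendsto_sum_sin_div (y := x - α) (by linarith) (by linarith))).div_const 2) using 2
    ring
end

section
/- For every real r with 0 ≤ r < 1 and every real y, the series Σ_{k=0}^∞ (−1)^k · r^{2k+1} · cos((2k+1) y)/(2k+1) converges absolutely and its sum equals (1/2) · arctan( 2 r cos y / (1 − r²) ). -/
theorem Complex.arg_eq_arctan_of_re_pos {w : ℂ} (hw : 0 < w.re) :
    w.arg = Real.arctan (w.im / w.re) := by
  have h := abs_lt.mp (Complex.abs_arg_lt_pi_div_two_iff.mpr (Or.inl hw))
  rw [← Complex.tan_arg, Real.arctan_tan h.1 h.2]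

theorem Complex.re_arctan_of_norm_lt_one {z : ℂ} (hz : ‖z‖ < 1) :
    (Complex.arctan z).re = 1 / 2 * Real.arctan (2 * z.re / (1 - ‖z‖ ^ 2)) := by
  have hz2 : 0 < 1 - ‖z‖ ^ 2 := by nlinarith [norm_nonneg z]
  have hne : 1 - z * I ≠ 0 := by
    intro h
    have : ‖z * I‖ = 1 := by rw [← sub_eq_zero.mp h, norm_one]
    rw [norm_mul, norm_I, mul_one] at this
    exact hz.ne this
  have hn : 0 < normSq (1 - z * I) := normSq_pos.mpr hne
  have hre : ((1 + z * I) / (1 - z * I)).re = (1 - ‖z‖ ^ 2) / normSq (1 - z * I) := by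
    rw [div_re, ← add_div, ← normSq_eq_norm_sq, normSq_apply z]
    congr 1
    simp
    ring
  have him : ((1 + z * I) / (1 - z * I)).im = 2 * z.re / normSq (1 - z * I) := by
    rw [div_im, ← sub_div]
    congr 1
    simp
    ring
  have harctan : (arctan z).re = 1 / 2 * ((1 + z * I) / (1 - z * I)).arg := by
    rw [arctan, ← log_im, show -I / 2 = ((1 / 2 : ℝ) : ℂ) * -I by push_cast; ring, mul_assoc,
      re_ofReal_mul]
    simp
  rw [harctan, arg_eq_arctan_of_re_pos (hre ▸ div_pos hz2 hn), hre, him,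
    div_div_div_cancel_right₀ hn.ne']

theorem stmt_9 (r : ℝ) (hr0 : 0 ≤ r) (hr1 : r < 1) (y : ℝ) :
    Summable (fun k : ℕ =>
      |(-1 : ℝ) ^ k * r ^ (2 * k + 1) * Real.cos ((2 * (k : ℝ) + 1) * y)
        / (2 * (k : ℝ) + 1)|) ∧
    (∑' k : ℕ, (-1 : ℝ) ^ k * r ^ (2 * k + 1) * Real.cos ((2 * (k : ℝ) + 1) * y)
        / (2 * (k : ℝ) + 1))
      = (1 / 2) * Real.arctan (2 * r * Real.cos y / (1 - r ^ 2)) := by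
  set z : ℂ := r * Complex.exp (y * Complex.I) with hz
  have hnorm : ‖z‖ = r := by
    rw [hz, norm_mul, Complex.norm_exp_ofReal_mul_I, mul_one, Complex.norm_real,
      Real.norm_of_nonneg hr0]
  have hzre : z.re = r * Real.cos y := by
    rw [hz, Complex.re_ofReal_mul, Complex.exp_ofReal_mul_I_re]
  have hlt : ‖z‖ < 1 := hnorm.trans_lt hr1
  have hterm (k : ℕ) : ((-1 : ℂ) ^ k * z ^ (2 * k + 1) / ↑(2 * k + 1)).re =
      (-1 : ℝ) ^ k * r ^ (2 * k + 1) * Real.cos ((2 * (k : ℝ) + 1) * y) / (2 * (k : ℝ) + 1) := by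
    have : (-1 : ℂ) ^ k * z ^ (2 * k + 1) / ↑(2 * k + 1) =
        (((-1 : ℝ) ^ k * r ^ (2 * k + 1) / (2 * (k : ℝ) + 1) : ℝ) : ℂ) *
          Complex.exp (((2 * (k : ℝ) + 1) * y : ℝ) * Complex.I) := by
      rw [hz, mul_pow, ← Complex.exp_nat_mul]
      push_cast
      rw [← mul_assoc _ (y : ℂ) Complex.I]
      ring
    rw [this, Complex.re_ofReal_mul, Complex.exp_ofReal_mul_I_re]
    ring
  have hsum := Complex.hasSum_re (Complex.hasSum_arctan hlt)
  simp_rw [hterm] at hsum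
  refine ⟨hsum.summable.abs, ?_⟩
  rw [hsum.tsum_eq, Complex.re_arctan_of_norm_lt_one hlt, hnorm, hzre, mul_assoc]
end

section
/- Define v : ℝ → ℝ → ℝ by v x y = Σ_{k=0}^∞ (−1)^k · e^{−(2k+1) x} · cos((2k+1) y)/(2k+1) (the series converging absolutely for every x > 0). Then for every x > 0 and every real y: the second derivative at x of the function s ↦ v s y, plus the second derivative at y of the function s ↦ v x s, equals 0; moreover v x (π/2) = 0 and v x (−π/2) = 0 for every x > 0. -/
theorem iteratedDeriv_two_tsum_of_isPreconnected {α : Type*} {f f' f'' : α → ℝ → ℝ} {u : α → ℝ}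
    {t : Set ℝ} {x : ℝ} (hu : Summable u) (ht : IsOpen t) (h't : IsPreconnected t)
    (hf : ∀ i, ∀ y ∈ t, HasDerivAt (f i) (f' i y) y)
    (hf' : ∀ i, ∀ y ∈ t, HasDerivAt (f' i) (f'' i y) y)
    (hb' : ∀ i, ∀ y ∈ t, ‖f' i y‖ ≤ u i) (hb'' : ∀ i, ∀ y ∈ t, ‖f'' i y‖ ≤ u i)
    (hx : x ∈ t) (hsum : Summable fun i => f i x) :
    iteratedDeriv 2 (fun y => ∑' i, f i y) x = ∑' i, f'' i x := by
  have h1 : deriv (fun y => ∑' i, f i y) =ᶠ[nhds x] fun y => ∑' i, f' i y := by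
    filter_upwards [ht.mem_nhds hx] with y hy
    exact (hasDerivAt_tsum_of_isPreconnected hu ht h't hf hb' hx hsum hy).deriv
  rw [iteratedDeriv_succ, iteratedDeriv_one, h1.deriv_eq]
  exact (hasDerivAt_tsum_of_isPreconnected hu ht h't hf' hb'' hx
    (.of_norm_bounded hu fun i => hb' i x hx) hx).deriv

theorem summable_odd_mul_exp_neg {δ : ℝ} (hδ : 0 < δ) :
    Summable fun k : ℕ => (2 * (k : ℝ) + 1) * Real.exp (-(2 * (k : ℝ) + 1) * δ) := by
  have h := (Real.summable_pow_mul_exp_neg_nat_mul 1 hδ).comp_injective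
    (i := fun k : ℕ => 2 * k + 1) fun a b hab => by simpa using hab
  refine h.congr fun k => ?_
  simp only [Function.comp_apply, pow_one]
  push_cast
  ring_nf

theorem abs_neg_one_pow_mul_le {a b c d : ℝ} (k : ℕ) (ha : |a| ≤ c) (hb : |b| ≤ d) :
    |(-1 : ℝ) ^ k * a * b| ≤ c * d := by
  rw [abs_mul, abs_mul, abs_neg_one_pow, one_mul]
  exact mul_le_mul ha hb (abs_nonneg b) ((abs_nonneg a).trans ha)

theorem cos_odd_mul_pi_div_two (k : ℕ) : Real.cos ((2 * (k : ℝ) + 1) * (Real.pi / 2)) = 0 :=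
  Real.cos_eq_zero_iff.mpr ⟨k, by push_cast; ring⟩

theorem stmt_10 (v : ℝ → ℝ → ℝ)
    (hv : ∀ x y : ℝ, v x y = ∑' k : ℕ,
      (-1 : ℝ) ^ k * Real.exp (-(2 * (k : ℝ) + 1) * x) * Real.cos ((2 * (k : ℝ) + 1) * y)
        / (2 * (k : ℝ) + 1)) :
    (∀ x : ℝ, 0 < x → ∀ y : ℝ, Summable fun k : ℕ =>
      |(-1 : ℝ) ^ k * Real.exp (-(2 * (k : ℝ) + 1) * x) * Real.cos ((2 * (k : ℝ) + 1) * y)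
        / (2 * (k : ℝ) + 1)|) ∧
    (∀ x : ℝ, 0 < x → ∀ y : ℝ,
      iteratedDeriv 2 (fun s => v s y) x + iteratedDeriv 2 (fun s => v x s) y = 0) ∧
    (∀ x : ℝ, 0 < x → v x (Real.pi / 2) = 0 ∧ v x (-(Real.pi / 2)) = 0) := by
  have hm (k : ℕ) : (1 : ℝ) ≤ 2 * k + 1 := by
    have : (0 : ℝ) ≤ k := k.cast_nonneg
    linarith
  have hsum (x : ℝ) (hx : 0 < x) (y : ℝ) : Summable fun k : ℕ =>
      |(-1 : ℝ) ^ k * Real.exp (-(2 * (k : ℝ) + 1) * x) * Real.cos ((2 * (k : ℝ) + 1) * y)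
        / (2 * (k : ℝ) + 1)| := by
    refine .of_nonneg_of_le (fun _ => abs_nonneg _) (fun k => ?_) (summable_odd_mul_exp_neg hx)
    have hk := hm k
    rw [abs_div, abs_of_pos (a := 2 * (k : ℝ) + 1) (by linarith)]
    refine (div_le_self (abs_nonneg _) hk).trans ?_
    refine (abs_neg_one_pow_mul_le k (Real.abs_exp _).le (Real.abs_cos_le_one _)).trans ?_
    rw [mul_one]
    exact le_mul_of_one_le_left (Real.exp_pos _).le hk
  refine ⟨hsum, fun x hx y => ?_, fun x _ => ?_⟩
  · have hbound (k : ℕ) (s : ℝ) (hs : x / 2 < s) (T : ℝ) (hT : |T| ≤ 1) :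
        |(-1 : ℝ) ^ k * ((2 * (k : ℝ) + 1) * Real.exp (-(2 * (k : ℝ) + 1) * s)) * T| ≤
          (2 * (k : ℝ) + 1) * Real.exp (-(2 * (k : ℝ) + 1) * (x / 2)) := by
      have hk := hm k
      rw [← mul_one ((2 * (k : ℝ) + 1) * Real.exp (-(2 * (k : ℝ) + 1) * (x / 2)))]
      refine abs_neg_one_pow_mul_le k ?_ hT
      rw [abs_of_nonneg (by positivity)]
      gcongr ?_ * Real.exp ?_
      nlinarith
    have hu := summable_odd_mul_exp_neg (half_pos hx)
    have hxx := iteratedDeriv_two_tsum_of_isPreconnected (x := x)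
      (f := fun (k : ℕ) s => (-1 : ℝ) ^ k * Real.exp (-(2 * (k : ℝ) + 1) * s) *
        Real.cos ((2 * (k : ℝ) + 1) * y) / (2 * (k : ℝ) + 1))
      (f' := fun (k : ℕ) s => -((-1 : ℝ) ^ k * Real.exp (-(2 * (k : ℝ) + 1) * s) *
        Real.cos ((2 * (k : ℝ) + 1) * y)))
      (f'' := fun (k : ℕ) s => (-1 : ℝ) ^ k * ((2 * (k : ℝ) + 1) *
        Real.exp (-(2 * (k : ℝ) + 1) * s)) * Real.cos ((2 * (k : ℝ) + 1) * y))
      hu isOpen_Ioi (isPreconnected_Ioi (a := x / 2))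
      (fun k s _ => by
        have hk := hm k
        have h := ((hasDerivAt_id s).const_mul (-(2 * (k : ℝ) + 1))).exp
        convert! (((h.const_mul ((-1 : ℝ) ^ k)).mul_const
          (Real.cos ((2 * (k : ℝ) + 1) * y))).div_const (2 * (k : ℝ) + 1)) using 1
        simp only [id]
        field_simp)
      (fun k s _ => by
        have h := ((hasDerivAt_id s).const_mul (-(2 * (k : ℝ) + 1))).exp
        convert! ((h.const_mul ((-1 : ℝ) ^ k)).mul_const
          (Real.cos ((2 * (k : ℝ) + 1) * y))).neg using 1
        simp only [id]
        ring)
      (fun k s hs => by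
        refine le_trans ?_ (hbound k s hs _ (Real.abs_cos_le_one ((2 * (k : ℝ) + 1) * y)))
        rw [norm_neg, Real.norm_eq_abs]
        simp only [abs_mul]
        gcongr
        exact le_mul_of_one_le_left (abs_nonneg _) ((hm k).trans (le_abs_self _)))
      (fun k s hs => hbound k s hs _ (Real.abs_cos_le_one _))
      (Set.mem_Ioi.mpr (half_lt_self hx)) (hsum x hx y).of_abs
    have hyy := iteratedDeriv_two_tsum_of_isPreconnected (x := y)
      (f := fun (k : ℕ) s => (-1 : ℝ) ^ k * Real.exp (-(2 * (k : ℝ) + 1) * x) *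
        Real.cos ((2 * (k : ℝ) + 1) * s) / (2 * (k : ℝ) + 1))
      (f' := fun (k : ℕ) s => -((-1 : ℝ) ^ k * Real.exp (-(2 * (k : ℝ) + 1) * x) *
        Real.sin ((2 * (k : ℝ) + 1) * s)))
      (f'' := fun (k : ℕ) s => -((-1 : ℝ) ^ k * ((2 * (k : ℝ) + 1) *
        Real.exp (-(2 * (k : ℝ) + 1) * x)) * Real.cos ((2 * (k : ℝ) + 1) * s)))
      hu isOpen_univ isPreconnected_univ
      (fun k s _ => by
        have hk := hm k
        have h := ((hasDerivAt_id s).const_mul (2 * (k : ℝ) + 1)).cos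
        convert! ((h.const_mul ((-1 : ℝ) ^ k *
          Real.exp (-(2 * (k : ℝ) + 1) * x))).div_const (2 * (k : ℝ) + 1)) using 1
        simp only [id]
        field_simp)
      (fun k s _ => by
        have h := ((hasDerivAt_id s).const_mul (2 * (k : ℝ) + 1)).sin
        convert! (h.const_mul ((-1 : ℝ) ^ k * Real.exp (-(2 * (k : ℝ) + 1) * x))).neg using 1
        simp only [id]
        ring)
      (fun k s _ => by
        refine le_trans ?_ (hbound k x (half_lt_self hx) _
          (Real.abs_sin_le_one ((2 * (k : ℝ) + 1) * s)))
        rw [norm_neg, Real.norm_eq_abs]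
        simp only [abs_mul]
        gcongr
        exact le_mul_of_one_le_left (abs_nonneg _) ((hm k).trans (le_abs_self _)))
      (fun k s _ => by
        rw [norm_neg]
        exact hbound k x (half_lt_self hx) _ (Real.abs_cos_le_one _))
      (Set.mem_univ y) (hsum x hx y).of_abs
    simp only [hv]
    rw [hxx, hyy, tsum_neg, add_neg_cancel]
  · simp [hv, mul_neg, Real.cos_neg, cos_odd_mul_pi_div_two]
end

section
/- Let c > 0 and let u : ℝ → ℝ → ℝ be such that (x, t) ↦ u x t is twice continuously differentiable on ℝ² (ContDiff ℝ 2) and satisfies, for all (x, t), that the second derivative at t of s ↦ u x s equals c² times the second derivative at x of s ↦ u s t. Then there exist twice differentiable functions F, G : ℝ → ℝ such that u x t = F(x + c·t) + G(x − c·t) for all x, t. -/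
section SecondDerivatives

variable {E : Type*} [NormedAddCommGroup E] [NormedSpace ℝ E]

theorem ContDiff.hasDerivAt_fderiv_apply_comp {f : E → ℝ} (hf : ContDiff ℝ 2 f)
    {γ : ℝ → E} {v : E} {s : ℝ} (hγ : HasDerivAt γ v s) (w : E) :
    HasDerivAt (fun r => fderiv ℝ f (γ r) w) (fderiv ℝ (fderiv ℝ f) (γ s) v w) s := by
  have hd : Differentiable ℝ (fderiv ℝ f) :=
    (hf.fderiv_right (m := 1) (by norm_num)).differentiable (by norm_num)
  have h := ((hd (γ s)).hasFDerivAt.comp_hasDerivAt s hγ).clm_apply (hasDerivAt_const s w)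
  simpa using h

theorem ContDiff.iteratedDeriv_two_comp {f : E → ℝ} (hf : ContDiff ℝ 2 f)
    {γ : ℝ → E} {v : E} (hγ : ∀ s, HasDerivAt γ v s) (s : ℝ) :
    iteratedDeriv 2 (fun r => f (γ r)) s = fderiv ℝ (fderiv ℝ f) (γ s) v v := by
  have h1 : deriv (fun r => f (γ r)) = fun r => fderiv ℝ f (γ r) v := by
    funext r
    exact ((hf.differentiable (by norm_num) (γ r)).hasFDerivAt.comp_hasDerivAt r (hγ r)).deriv
  rw [iteratedDeriv_succ, iteratedDeriv_one, h1]
  exact (hf.hasDerivAt_fderiv_apply_comp (hγ s) v).deriv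

/-- A `C²` function whose mixed second derivative in the directions `v`, `w` vanishes on the plane
they span splits there as a sum of functions of one variable. -/
theorem ContDiff.add_eq_add_of_fderiv_fderiv_eq_zero {f : E → ℝ} (hf : ContDiff ℝ 2 f) {v w : E}
    (h : ∀ p, fderiv ℝ (fderiv ℝ f) p v w = 0) (a b : ℝ) :
    f (a • v + b • w) + f 0 = f (a • v) + f (b • w) := by
  have hv (q : E) (s : ℝ) : HasDerivAt (fun r : ℝ => r • v + q) v s := by
    simpa using ((hasDerivAt_id s).smul_const v).add_const q
  have hw (q : E) (s : ℝ) : HasDerivAt (fun r : ℝ => q + r • w) w s := by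
    simpa using ((hasDerivAt_id s).smul_const w).const_add q
  have hconst (q : E) : fderiv ℝ f (a • v + q) w = fderiv ℝ f q w := by
    have hd (s : ℝ) := hf.hasDerivAt_fderiv_apply_comp (hv q s) w
    simpa using is_const_of_deriv_eq_zero (fun s => (hd s).differentiableAt)
      (fun s => (hd s).deriv.trans (h _)) a 0
  have hf' : Differentiable ℝ f := hf.differentiable (by norm_num)
  have hd (s : ℝ) : HasDerivAt (fun r : ℝ => f (a • v + r • w) - f (0 + r • w)) 0 s := by
    have := ((hf' _).hasFDerivAt.comp_hasDerivAt s (hw (a • v) s)).sub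
      ((hf' _).hasFDerivAt.comp_hasDerivAt s (hw 0 s))
    rw [hconst, zero_add, sub_self] at this
    exact this
  have := is_const_of_deriv_eq_zero (fun s => (hd s).differentiableAt) (fun s => (hd s).deriv) b 0
  simp only [zero_smul, add_zero, zero_add] at this
  linarith

end SecondDerivatives

theorem stmt_12 (c : ℝ) (hc : 0 < c) (u : ℝ → ℝ → ℝ)
    (hreg : ContDiff ℝ 2 (Function.uncurry u))
    (hwave : ∀ x t : ℝ,
      iteratedDeriv 2 (fun s => u x s) t = c ^ 2 * iteratedDeriv 2 (fun s => u s t) x) :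
    ∃ F G : ℝ → ℝ,
      Differentiable ℝ F ∧ Differentiable ℝ (deriv F) ∧
      Differentiable ℝ G ∧ Differentiable ℝ (deriv G) ∧
      ∀ x t : ℝ, u x t = F (x + c * t) + G (x - c * t) := by
  set f := Function.uncurry u
  let e₁ : ℝ × ℝ := (1, 0)
  let e₂ : ℝ × ℝ := (0, 1)
  let v : ℝ × ℝ := (1 / 2 : ℝ) • e₁ + (1 / (2 * c)) • e₂
  let w : ℝ × ℝ := (1 / 2 : ℝ) • e₁ - (1 / (2 * c)) • e₂
  have hmixed (p : ℝ × ℝ) : fderiv ℝ (fderiv ℝ f) p v w = 0 := by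
    have htt : iteratedDeriv 2 (fun s => u p.1 s) p.2 = fderiv ℝ (fderiv ℝ f) p e₂ e₂ :=
      hreg.iteratedDeriv_two_comp (γ := fun s => (p.1, s))
        (fun s => (hasDerivAt_const s p.1).prodMk (hasDerivAt_id s)) p.2
    have hxx : iteratedDeriv 2 (fun s => u s p.2) p.1 = fderiv ℝ (fderiv ℝ f) p e₁ e₁ :=
      hreg.iteratedDeriv_two_comp (γ := fun s => (s, p.2))
        (fun s => (hasDerivAt_id s).prodMk (hasDerivAt_const s p.2)) p.1
    have hsymm : fderiv ℝ (fderiv ℝ f) p e₁ e₂ = fderiv ℝ (fderiv ℝ f) p e₂ e₁ :=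
      (hreg.contDiffAt.isSymmSndFDerivAt (by simp)) e₁ e₂
    have hp := hwave p.1 p.2
    rw [htt, hxx] at hp
    simp only [v, w, map_add, map_sub, map_smul, add_apply, smul_apply, smul_eq_mul, hsymm, hp]
    field_simp
    ring
  have hsmul (z : ℝ × ℝ) : ContDiff ℝ 2 fun r : ℝ => f (r • z) :=
    hreg.comp (contDiff_id.smul contDiff_const)
  have hderiv {g : ℝ → ℝ} (hg : ContDiff ℝ 2 g) : Differentiable ℝ (deriv g) :=
    (contDiff_succ_iff_deriv (n := 1).1 hg).2.2.differentiable (by norm_num)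
  have hG : ContDiff ℝ 2 fun r : ℝ => f (r • w) - f 0 := (hsmul w).sub contDiff_const
  refine ⟨fun r => f (r • v), fun r => f (r • w) - f 0, (hsmul v).differentiable (by norm_num),
    hderiv (hsmul v), hG.differentiable (by norm_num), hderiv hG, fun x t => ?_⟩
  have hxt : (x + c * t) • v + (x - c * t) • w = (x, t) := by
    ext
    · simp [v, w, e₁, e₂]
      ring
    · simp [v, w, e₁, e₂]
      field_simp
      ring
  have := hreg.add_eq_add_of_fderiv_fderiv_eq_zero hmixed (x + c * t) (x - c * t)
  rw [hxt] at this
  change f (x, t) = _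
  linarith
end

section
/- Let l > 0, c > 0, and let f : ℝ → ℝ be twice differentiable, odd (f(−s) = −f(s) for all s), and 2l-periodic (f(s + 2l) = f(s) for all s). Define u x t = (f(x + c·t) + f(x − c·t))/2. Then: (i) for all x, t, the second derivative at t of s ↦ u x s equals c² times the second derivative at x of s ↦ u s t; (ii) u x 0 = f x for all x; (iii) the derivative at t = 0 of s ↦ u x s equals 0 for all x; (iv) u 0 t = 0 and u l t = 0 for all t. -/
theorem hasDerivAt_comp_add_mul {g : ℝ → ℝ} (hg : Differentiable ℝ g) (a b s : ℝ) :
    HasDerivAt (fun s => g (a + b * s)) (b * deriv g (a + b * s)) s := by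
  have h : HasDerivAt (fun s : ℝ => a + b * s) b s := by
    simpa using ((hasDerivAt_id s).const_mul b).const_add a
  rw [mul_comm]
  exact (hg (a + b * s)).hasDerivAt.comp s h

theorem deriv_linear_combination_comp_add_mul {g : ℝ → ℝ} (hg : Differentiable ℝ g) (p a b q d e : ℝ) :
    deriv (fun s => p * g (a + b * s) + q * g (d + e * s)) =
      fun s => p * b * deriv g (a + b * s) + q * e * deriv g (d + e * s) := by
  funext s
  have h := ((hasDerivAt_comp_add_mul hg a b s).const_mul p).add
    ((hasDerivAt_comp_add_mul hg d e s).const_mul q)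
  rw [mul_assoc, mul_assoc]
  exact h.deriv

theorem stmt_13 (l c : ℝ) (hl : 0 < l) (hc : 0 < c) (f : ℝ → ℝ)
    (hf1 : Differentiable ℝ f) (hf2 : Differentiable ℝ (deriv f))
    (hodd : ∀ s : ℝ, f (-s) = -f s) (hper : ∀ s : ℝ, f (s + 2 * l) = f s)
    (u : ℝ → ℝ → ℝ) (hu : ∀ x t : ℝ, u x t = (f (x + c * t) + f (x - c * t)) / 2) :
    (∀ x t : ℝ,
      iteratedDeriv 2 (fun s => u x s) t = c ^ 2 * iteratedDeriv 2 (fun s => u s t) x) ∧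
    (∀ x : ℝ, u x 0 = f x) ∧
    (∀ x : ℝ, deriv (fun s => u x s) 0 = 0) ∧
    (∀ t : ℝ, u 0 t = 0 ∧ u l t = 0) := by
  have htime (x : ℝ) : (fun s => u x s) =
      fun s => 1 / 2 * f (x + c * s) + 1 / 2 * f (x + -c * s) := by
    funext s
    rw [hu, neg_mul, ← sub_eq_add_neg]
    ring
  have hspace (t : ℝ) : (fun s => u s t) =
      fun s => 1 / 2 * f (c * t + 1 * s) + 1 / 2 * f (-(c * t) + 1 * s) := by
    funext s
    rw [hu, one_mul, add_comm (c * t), neg_add_eq_sub]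
    ring
  refine ⟨fun x t => ?_, fun x => ?_, fun x => ?_, fun t => ⟨?_, ?_⟩⟩
  · simp only [iteratedDeriv_succ, iteratedDeriv_zero]
    rw [htime, hspace, deriv_linear_combination_comp_add_mul hf1, deriv_linear_combination_comp_add_mul hf1,
      deriv_linear_combination_comp_add_mul hf2, deriv_linear_combination_comp_add_mul hf2]
    have h₁ : c * t + 1 * x = x + c * t := by ring
    have h₂ : -(c * t) + 1 * x = x + -c * t := by ring
    simp only [h₁, h₂]
    ring
  · simp [hu]
  · rw [htime, deriv_linear_combination_comp_add_mul hf1]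
    simp
  · simp [hu, hodd]
  · have h : f (l - c * t) = -f (l + c * t) := by
      rw [← hodd, ← hper (-(l + c * t))]
      ring_nf
    simp [hu, h]
end

section
/- Let a > 0, c > 0, and let α : ℕ → ℝ satisfy Σ_{n=1}^∞ n² · |α n| < ∞. Define y x t = Σ_{n=1}^∞ α n · sin(n π x / a) · cos(n π c t / a). Then the series converges absolutely for all (x, t); for all (x, t), the second derivative at t of s ↦ y x s equals c² times the second derivative at x of s ↦ y s t; and y 0 t = 0 and y a t = 0 for all t. -/
theorem hasDerivAt_tsum_mul_comp_mul {f f' : ℝ → ℝ} (hf : ∀ x, HasDerivAt f (f' x) x)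
    (hb : ∀ x, |f x| ≤ 1) (hb' : ∀ x, |f' x| ≤ 1) {β ω : ℕ → ℝ} (h0 : Summable fun n => |β n|)
    (h1 : Summable fun n => |β n * ω n|) (x : ℝ) :
    HasDerivAt (fun s => ∑' n, β n * f (ω n * s)) (∑' n, β n * ω n * f' (ω n * x)) x := by
  refine hasDerivAt_tsum (g := fun n s => β n * f (ω n * s))
    (g' := fun n s => β n * ω n * f' (ω n * s)) h1 (fun n s => ?_) (fun n s => ?_)
    (y₀ := 0) (.of_norm_bounded h0 fun n => ?_) x
  · have h := ((hf (ω n * s)).comp s ((hasDerivAt_id s).const_mul (ω n))).const_mul (β n)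
    convert! h using 1
    ring
  · rw [Real.norm_eq_abs, abs_mul]
    exact mul_le_of_le_one_right (abs_nonneg _) (hb' _)
  · rw [Real.norm_eq_abs, abs_mul]
    exact mul_le_of_le_one_right (abs_nonneg _) (hb _)

theorem iteratedDeriv_two_tsum_mul_comp_mul {f f' f'' : ℝ → ℝ}
    (hf : ∀ x, HasDerivAt f (f' x) x) (hf' : ∀ x, HasDerivAt f' (f'' x) x)
    (hb : ∀ x, |f x| ≤ 1) (hb' : ∀ x, |f' x| ≤ 1) (hb'' : ∀ x, |f'' x| ≤ 1) {β ω : ℕ → ℝ}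
    (h0 : Summable fun n => |β n|) (h2 : Summable fun n => |β n * ω n ^ 2|) (x : ℝ) :
    iteratedDeriv 2 (fun s => ∑' n, β n * f (ω n * s)) x =
      ∑' n, β n * ω n ^ 2 * f'' (ω n * x) := by
  have h1 : Summable fun n => |β n * ω n| := by
    refine .of_nonneg_of_le (fun n => abs_nonneg _) (fun n => ?_) (h0.add h2)
    rw [abs_mul, abs_mul, abs_pow]
    nlinarith [abs_nonneg (β n), mul_nonneg (abs_nonneg (β n)) (sq_nonneg (|ω n| - 1)),
      mul_nonneg (abs_nonneg (β n)) (sq_nonneg (|ω n|))]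
  have h2' : Summable fun n => |β n * ω n * ω n| := by simpa only [mul_assoc, sq] using h2
  rw [iteratedDeriv_succ, iteratedDeriv_one,
    funext fun s => (hasDerivAt_tsum_mul_comp_mul hf hb hb' h0 h1 s).deriv,
    (hasDerivAt_tsum_mul_comp_mul hf' hb' hb'' h1 h2' x).deriv]
  simp only [mul_assoc, sq]

theorem iteratedDeriv_two_tsum_mul_sin_mul {β ω : ℕ → ℝ} (h0 : Summable fun n => |β n|)
    (h2 : Summable fun n => |β n * ω n ^ 2|) (x : ℝ) :
    iteratedDeriv 2 (fun s => ∑' n, β n * Real.sin (ω n * s)) x =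
      ∑' n, β n * ω n ^ 2 * -Real.sin (ω n * x) :=
  iteratedDeriv_two_tsum_mul_comp_mul Real.hasDerivAt_sin Real.hasDerivAt_cos
    Real.abs_sin_le_one Real.abs_cos_le_one
    (fun x => (abs_neg (Real.sin x)).trans_le (Real.abs_sin_le_one x)) h0 h2 x

theorem iteratedDeriv_two_tsum_mul_cos_mul {β ω : ℕ → ℝ} (h0 : Summable fun n => |β n|)
    (h2 : Summable fun n => |β n * ω n ^ 2|) (x : ℝ) :
    iteratedDeriv 2 (fun s => ∑' n, β n * Real.cos (ω n * s)) x =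
      ∑' n, β n * ω n ^ 2 * -Real.cos (ω n * x) :=
  iteratedDeriv_two_tsum_mul_comp_mul Real.hasDerivAt_cos
    (fun x => (Real.hasDerivAt_sin x).neg) Real.abs_cos_le_one
    (fun x => (abs_neg (Real.sin x)).trans_le (Real.abs_sin_le_one x))
    (fun x => (abs_neg (Real.cos x)).trans_le (Real.abs_cos_le_one x)) h0 h2 x

theorem summable_abs_mul_mul_of_abs_le_one {β γ δ : ℕ → ℝ} (h : Summable fun n => |β n * δ n|)
    (hγ : ∀ n, |γ n| ≤ 1) : Summable fun n => |β n * γ n * δ n| := by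
  refine .of_nonneg_of_le (fun n => abs_nonneg _) (fun n => ?_) h
  rw [mul_right_comm, abs_mul]
  exact mul_le_of_le_one_right (abs_nonneg _) (hγ n)

theorem stmt_14 (a c : ℝ) (ha : 0 < a) (hc : 0 < c) (α : ℕ → ℝ)
    (hα : Summable fun n : ℕ => (n : ℝ) ^ 2 * |α n|)
    (y : ℝ → ℝ → ℝ)
    (hy : ∀ x t : ℝ, y x t = ∑' n : ℕ,
      α (n + 1) * Real.sin (((n : ℝ) + 1) * Real.pi * x / a)
        * Real.cos (((n : ℝ) + 1) * Real.pi * c * t / a)) :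
    (∀ x t : ℝ, Summable fun n : ℕ =>
      |α (n + 1) * Real.sin (((n : ℝ) + 1) * Real.pi * x / a)
        * Real.cos (((n : ℝ) + 1) * Real.pi * c * t / a)|) ∧
    (∀ x t : ℝ,
      iteratedDeriv 2 (fun s => y x s) t = c ^ 2 * iteratedDeriv 2 (fun s => y s t) x) ∧
    (∀ t : ℝ, y 0 t = 0 ∧ y a t = 0) := by
  have hα' : Summable fun n : ℕ => ((n : ℝ) + 1) ^ 2 * |α (n + 1)| := by
    simpa using (summable_nat_add_iff 1).2 hα
  have h0 : Summable fun n : ℕ => |α (n + 1)| := by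
    refine .of_nonneg_of_le (fun n => abs_nonneg _) (fun n => ?_) hα'
    exact le_mul_of_one_le_left (abs_nonneg _) (one_le_pow₀ (by simp))
  have h2 (k : ℝ) : Summable fun n : ℕ => |α (n + 1) * (((n : ℝ) + 1) * k) ^ 2| := by
    refine (hα'.mul_right (k ^ 2)).congr fun n => ?_
    rw [abs_mul, abs_of_nonneg (sq_nonneg (((n : ℝ) + 1) * k))]
    ring
  have h0' {γ : ℕ → ℝ} (hγ : ∀ n, |γ n| ≤ 1) : Summable fun n : ℕ => |α (n + 1) * γ n| := by
    simpa using summable_abs_mul_mul_of_abs_le_one (δ := fun _ => 1) (by simpa using h0) hγ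
  have hx (n : ℕ) (x : ℝ) : ((n : ℝ) + 1) * Real.pi * x / a = (n + 1) * (Real.pi / a) * x := by
    ring
  have ht (n : ℕ) (t : ℝ) :
      ((n : ℝ) + 1) * Real.pi * c * t / a = (n + 1) * (Real.pi * c / a) * t := by
    ring
  refine ⟨fun x t => ?_, fun x t => ?_, fun t => ⟨?_, ?_⟩⟩
  · simp_rw [mul_assoc (α _)]
    refine h0' fun n => ?_
    rw [abs_mul]
    exact mul_le_one₀ (Real.abs_sin_le_one _) (abs_nonneg _) (Real.abs_cos_le_one _)
  · simp_rw [hy, hx, ht]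
    rw [iteratedDeriv_two_tsum_mul_cos_mul (h0' fun n => Real.abs_sin_le_one _)
      (summable_abs_mul_mul_of_abs_le_one (h2 _) fun n => Real.abs_sin_le_one _)]
    simp_rw [mul_right_comm (α _) (Real.sin _)]
    rw [iteratedDeriv_two_tsum_mul_sin_mul (h0' fun n => Real.abs_cos_le_one _)
      (summable_abs_mul_mul_of_abs_le_one (h2 _) fun n => Real.abs_cos_le_one _), ← tsum_mul_left]
    exact tsum_congr fun n => by ring
  · simp [hy]
  · have hsin (n : ℕ) : Real.sin (((n : ℝ) + 1) * Real.pi * a / a) = 0 := by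
      rw [mul_div_cancel_right₀ _ ha.ne']
      exact_mod_cast Real.sin_nat_mul_pi (n + 1)
    simp [hy, hsin]
end

section
/- Let x be a real number that is not an integer multiple of 2π. For n ≥ 1 set S_n(x) = Σ_{k=1}^{n} cos(k x). Then the Cesàro means (1/N) · Σ_{n=1}^{N} S_n(x) converge to −1/2 as N → ∞. -/
theorem two_mul_one_sub_cos_mul_sum_cos (x : ℝ) (n : ℕ) :
    2 * (1 - Real.cos x) * ∑ k ∈ Finset.Icc 1 n, Real.cos ((k : ℝ) * x) =
      Real.cos (n * x) - Real.cos ((n + 1) * x) - (1 - Real.cos x) := by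
  induction n with
  | zero => simp
  | succ n ih =>
    rw [Finset.sum_Icc_succ_top (by omega), mul_add, ih]
    have h₁ : Real.cos (n * x) = Real.cos ((n + 1) * x - x) := by ring_nf
    have h₂ : Real.cos ((n + 1 + 1) * x) = Real.cos ((n + 1) * x + x) := by ring_nf
    push_cast
    rw [h₁, h₂, Real.cos_sub, Real.cos_add]
    ring

theorem two_mul_one_sub_cos_mul_sum_sum_cos (x : ℝ) (N : ℕ) :
    2 * (1 - Real.cos x) *
        ∑ n ∈ Finset.Icc 1 N, ∑ k ∈ Finset.Icc 1 n, Real.cos ((k : ℝ) * x) =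
      Real.cos x - Real.cos ((N + 1) * x) - N * (1 - Real.cos x) := by
  induction N with
  | zero => simp
  | succ N ih =>
    rw [Finset.sum_Icc_succ_top (by omega), mul_add, ih, two_mul_one_sub_cos_mul_sum_cos]
    push_cast
    ring

theorem stmt_15 (x : ℝ) (hx : ¬ ∃ m : ℤ, x = 2 * Real.pi * m) :
    Filter.Tendsto
      (fun N : ℕ => (1 / (N : ℝ)) * ∑ n ∈ Finset.Icc 1 N,
        ∑ k ∈ Finset.Icc 1 n, Real.cos ((k : ℝ) * x))
      Filter.atTop (nhds (-(1 / 2))) := by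
  have hc : 1 - Real.cos x ≠ 0 := by
    intro h
    obtain ⟨m, hm⟩ := (Real.cos_eq_one_iff x).1 (sub_eq_zero.1 h).symm
    exact hx ⟨m, by rw [← hm]; ring⟩
  have hbdd : ∀ N : ℕ, |Real.cos x - Real.cos ((N + 1) * x)| ≤ 2 := fun N =>
    (abs_sub _ _).trans (by
      linarith [Real.abs_cos_le_one x, Real.abs_cos_le_one ((N + 1) * x)])
  have hlim : Filter.Tendsto
      (fun N : ℕ => (Real.cos x - Real.cos ((N + 1) * x)) / (N : ℝ)) Filter.atTop (nhds 0) :=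
    squeeze_zero_norm
      (fun N => by
        rw [Real.norm_eq_abs, abs_div, Nat.abs_cast]
        exact div_le_div_of_nonneg_right (hbdd N) N.cast_nonneg)
      (tendsto_const_div_atTop_nhds_zero_nat 2)
  have hmain := (hlim.div_const (2 * (1 - Real.cos x))).add_const (-(1 / 2))
  rw [zero_div, zero_add] at hmain
  refine hmain.congr' ?_
  filter_upwards [Filter.eventually_ne_atTop 0] with N hN
  have hN' : (N : ℝ) ≠ 0 := Nat.cast_ne_zero.2 hN
  have hsum := two_mul_one_sub_cos_mul_sum_sum_cos x N
  generalize ∑ n ∈ Finset.Icc 1 N, ∑ k ∈ Finset.Icc 1 n, Real.cos ((k : ℝ) * x) = S at hsum ⊢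
  field_simp
  linarith
end

section
/- Let φ : ℝ → ℝ be a polynomial function that is odd, i.e. φ(−x) = −φ(x) for all real x. Then for every integer n ≥ 1: ∫_{0}^{π} φ(x) · sin(n x) dx = ((−1)^{n+1}/n) · Σ_{k=0}^{∞} (−1)^k · φ^{(2k)}(π) / n^{2k}, where φ^{(2k)} denotes the 2k-th iterated derivative of φ, and the sum has only finitely many nonzero terms since φ is a polynomial. -/
open Polynomial in
/-- The antiderivative `-q cos(ax)/a + q' sin(ax)/a²` of `p sin(ax)`, where `q + q''/a² = p`. -/
theorem Polynomial.integral_eval_mul_sin {p q : ℝ[X]} {a : ℝ} (ha : a ≠ 0)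
    (h : ∀ x, q.eval x + (derivative (derivative q)).eval x / a ^ 2 = p.eval x) (s t : ℝ) :
    ∫ x in s..t, p.eval x * Real.sin (a * x) =
      (-(q.eval t * Real.cos (a * t)) / a + q.derivative.eval t * Real.sin (a * t) / a ^ 2) -
      (-(q.eval s * Real.cos (a * s)) / a + q.derivative.eval s * Real.sin (a * s) / a ^ 2) := by
  refine intervalIntegral.integral_eq_sub_of_hasDerivAt
    (f := fun x => -(q.eval x * Real.cos (a * x)) / a
      + q.derivative.eval x * Real.sin (a * x) / a ^ 2) (fun x _ => ?_) ?_
  · have hlin : HasDerivAt (fun y : ℝ => a * y) a x := by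
      simpa using (hasDerivAt_id x).const_mul a
    refine (((((q.hasDerivAt x).mul hlin.cos).neg).div_const a).add
      (((q.derivative.hasDerivAt x).mul hlin.sin).div_const (a ^ 2))).congr_deriv ?_
    rw [← h x]
    field_simp
    ring
  · exact (p.continuous.mul (by fun_prop)).intervalIntegrable _ _

theorem Polynomial.iteratedDeriv_eval (p : Polynomial ℝ) (k : ℕ) :
    iteratedDeriv k (fun x => p.eval x) = fun x => (Polynomial.derivative^[k] p).eval x := by
  induction k with
  | zero => simp
  | succ k ih =>
    ext x
    rw [iteratedDeriv_succ, ih, Function.iterate_succ_apply', Polynomial.deriv]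

theorem Function.Odd.iteratedDeriv_even_zero {f : ℝ → ℝ} (hf : f.Odd) (k : ℕ) :
    iteratedDeriv (2 * k) f 0 = 0 := by
  have h := iteratedDeriv_comp_neg (2 * k) f 0
  rw [funext hf, iteratedDeriv_fun_neg] at h
  simp at h
  linarith

theorem stmt_16 (φ : ℝ → ℝ) (p : Polynomial ℝ) (hφ : ∀ x : ℝ, φ x = p.eval x)
    (hodd : ∀ x : ℝ, φ (-x) = -φ x) (n : ℕ) (hn : 1 ≤ n) :
    ∫ x in (0:ℝ)..Real.pi, φ x * Real.sin ((n : ℝ) * x)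
      = ((-1 : ℝ) ^ (n + 1) / (n : ℝ)) *
        ∑' k : ℕ, (-1 : ℝ) ^ k * iteratedDeriv (2 * k) φ Real.pi / (n : ℝ) ^ (2 * k) := by
  have hn0 : (n : ℝ) ≠ 0 := by positivity
  obtain rfl : φ = fun x => p.eval x := funext hφ
  set N := p.natDegree + 1 with hN
  have hvanish : ∀ k, N ≤ k → Polynomial.derivative^[2 * k] p = 0 := fun k hk =>
    Polynomial.iterate_derivative_eq_zero (by omega)
  set q : Polynomial ℝ := ∑ k ∈ Finset.range N,
    Polynomial.C ((-1 : ℝ) ^ k / (n : ℝ) ^ (2 * k)) * Polynomial.derivative^[2 * k] p with hq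
  have hq_eval (x : ℝ) : q.eval x = ∑ k ∈ Finset.range N,
      (-1 : ℝ) ^ k / (n : ℝ) ^ (2 * k) * (Polynomial.derivative^[2 * k] p).eval x := by
    simp [hq, Polynomial.eval_finsetSum]
  have hode (x : ℝ) : q.eval x + q.derivative.derivative.eval x / (n : ℝ) ^ 2 = p.eval x := by
    let c (k : ℕ) : ℝ :=
      (-1 : ℝ) ^ k / (n : ℝ) ^ (2 * k) * (Polynomial.derivative^[2 * k] p).eval x
    have hdd : q.derivative.derivative.eval x / (n : ℝ) ^ 2 =
        -∑ k ∈ Finset.range N, c (k + 1) := by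
      simp only [hq, c, Polynomial.derivative_sum, Polynomial.derivative_C_mul,
        Polynomial.eval_finsetSum, Finset.sum_div, ← Finset.sum_neg_distrib,
        ← Function.iterate_succ_apply' (f := ⇑Polynomial.derivative), Polynomial.eval_C_mul]
      refine Finset.sum_congr rfl fun k _ => ?_
      simp only [Nat.succ_eq_add_one, mul_add, mul_one]
      field_simp
      ring
    have htel := Finset.sum_range_sub' c N
    have hcN : c N = 0 := by simp [c, hvanish N le_rfl]
    rw [hq_eval, hdd, ← sub_eq_add_neg, ← Finset.sum_sub_distrib, htel, hcN]
    simp [c]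
  have hq0 : q.eval 0 = 0 := by
    rw [hq_eval]
    refine Finset.sum_eq_zero fun k _ => ?_
    have h := Function.Odd.iteratedDeriv_even_zero (f := fun x => p.eval x) hodd k
    rw [Polynomial.iteratedDeriv_eval] at h
    simp [h]
  have hsum : ∑' k : ℕ, (-1 : ℝ) ^ k * iteratedDeriv (2 * k) (fun x => p.eval x) Real.pi /
      (n : ℝ) ^ (2 * k) = q.eval Real.pi := by
    simp only [Polynomial.iteratedDeriv_eval]
    rw [tsum_eq_sum (s := Finset.range N), hq_eval]
    · exact Finset.sum_congr rfl fun k _ => by ring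
    · intro k hk
      simp [hvanish k (by simpa using hk)]
  rw [hsum, Polynomial.integral_eval_mul_sin hn0 hode, hq0, Real.cos_nat_mul_pi,
    Real.sin_nat_mul_pi]
  simp
  ring
end

section
/- Let X > 0 and let f : ℝ → ℝ be continuously differentiable. For n ≥ 1 set b_n = (2/X) · ∫_{0}^{X} f(t) · sin(n π t / X) dt. Then for every x with 0 < x < X, the series Σ_{n=1}^∞ b_n · sin(n π x / X) converges and its sum equals f(x). -/
/-- **Riemann–Lebesgue lemma** for sine coefficients on a bounded interval. -/
theorem tendsto_integral_mul_sin_atTop {X : ℝ} (hX : 0 < X) {h : ℝ → ℝ}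
    (hh : ContinuousOn h (Set.Icc 0 X)) :
    Filter.Tendsto (fun N : ℕ => ∫ t in (0:ℝ)..X, h t * Real.sin ((N : ℝ) * Real.pi * t / X))
      Filter.atTop (nhds 0) := by
  have hint : MeasureTheory.IntegrableOn (fun t => (h t : ℂ)) (Set.Ioc 0 X) :=
    ((Complex.continuous_ofReal.comp_continuousOn hh).integrableOn_Icc).mono_set
      Set.Ioc_subset_Icc_self
  have hw : Filter.Tendsto (fun N : ℕ => (N : ℝ) / (2 * X)) Filter.atTop
      (Filter.cocompact ℝ) :=
    (tendsto_natCast_atTop_atTop.atTop_div_const (by positivity)).mono_right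
      atTop_le_cocompact
  have key := (Real.tendsto_integral_exp_smul_cocompact
    ((Set.Ioc 0 X).indicator fun t => (h t : ℂ))).comp hw
  have key2 := ((Complex.continuous_im.tendsto 0).comp key).neg
  simp only [Complex.zero_im, neg_zero] at key2
  refine key2.congr fun N => ?_
  have hpt : ∀ v : ℝ, Real.fourierChar (-(v * ((N : ℝ) / (2 * X)))) •
      (Set.Ioc 0 X).indicator (fun t => (h t : ℂ)) v =
      (Set.Ioc 0 X).indicator (fun t => Real.fourierChar (-(t * ((N : ℝ) / (2 * X)))) •
        (h t : ℂ)) v := by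
    intro v
    by_cases hv : v ∈ Set.Ioc 0 X <;> simp [hv]
  have hint2 : MeasureTheory.IntegrableOn (fun t => Real.fourierChar (-(t * ((N : ℝ) / (2 * X)))) •
        (h t : ℂ)) (Set.Ioc 0 X) := by
    refine (ContinuousOn.integrableOn_Icc ?_).mono_set Set.Ioc_subset_Icc_self
    refine ContinuousOn.smul (Continuous.continuousOn ?_)
      (Complex.continuous_ofReal.comp_continuousOn hh)
    have hlin : Continuous fun t : ℝ => -(t * ((N : ℝ) / (2 * X))) := by fun_prop
    exact continuous_subtype_val.comp (Real.continuous_fourierChar.comp hlin)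
  simp only [Function.comp_apply]
  simp_rw [hpt]
  rw [MeasureTheory.integral_indicator measurableSet_Ioc, intervalIntegral.integral_of_le hX.le]
  have him := integral_im hint2
  simp only [RCLike.im_to_complex] at him
  rw [← him, ← MeasureTheory.integral_neg]
  congr 1
  ext t
  have harg : 2 * Real.pi * -(t * ((N : ℝ) / (2 * X))) = -(N * Real.pi * t / X) := by
    field_simp
  rw [Circle.smul_def, Real.fourierChar_apply, harg, smul_eq_mul, Complex.im_mul_ofReal,
    Complex.exp_ofReal_mul_I_im, Real.sin_neg]
  ring

/-- A Christoffel–Darboux identity for the functions `sin (n * a)`. -/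
theorem two_mul_cos_sub_cos_mul_sum_sin_mul_sin (a b : ℝ) (N : ℕ) :
    2 * (Real.cos a - Real.cos b) * ∑ n ∈ Finset.Icc 1 N, Real.sin (n * a) * Real.sin (n * b) =
      Real.sin ((N + 1 : ℕ) * a) * Real.sin (N * b) -
        Real.sin (N * a) * Real.sin ((N + 1 : ℕ) * b) := by
  induction N with
  | zero => simp
  | succ N ih =>
    have rec_sin : ∀ c : ℝ, Real.sin ((N + 1 + 1 : ℕ) * c) =
        2 * Real.cos c * Real.sin ((N + 1 : ℕ) * c) - Real.sin (N * c) := by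
      intro c
      have h1 : ((N + 1 + 1 : ℕ) : ℝ) * c = (N + 1 : ℕ) * c + c := by push_cast; ring
      have h2 : (N : ℝ) * c = (N + 1 : ℕ) * c - c := by push_cast; ring
      rw [h1, h2, Real.sin_add, Real.sin_sub]
      ring
    rw [Finset.sum_Icc_succ_top (by omega), mul_add, ih, rec_sin a, rec_sin b]
    ring

/-- A continuous function on `[0, X]`, divisible by `cos (π t / X) - cos (π x / X)` with continuous
quotient, has a Fourier sine series that converges to `0` at `x`. -/
theorem tendsto_sineSeries_of_eq_cos_sub_cos_mul {X : ℝ} (hX : 0 < X) {f h : ℝ → ℝ} (x : ℝ)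
    (hf : Continuous f) (hh : ContinuousOn h (Set.Icc 0 X))
    (hfh : ∀ t ∈ Set.Icc 0 X,
      f t = (Real.cos (Real.pi * t / X) - Real.cos (Real.pi * x / X)) * h t) :
    Filter.Tendsto
      (fun N : ℕ => ∑ n ∈ Finset.Icc 1 N,
        ((2 / X) * ∫ t in (0:ℝ)..X, f t * Real.sin ((n : ℝ) * Real.pi * t / X)) *
          Real.sin ((n : ℝ) * Real.pi * x / X))
      Filter.atTop (nhds 0) := by
  have hlim := tendsto_integral_mul_sin_atTop hX hh
  have hbdd : ∀ k : ℕ, Filter.IsBoundedUnder (· ≤ ·) Filter.atTop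
      ((‖·‖) ∘ fun N : ℕ => Real.sin (((N + k : ℕ) : ℝ) * Real.pi * x / X)) := fun k =>
    Filter.isBoundedUnder_of ⟨1, fun N => by
      simpa [Real.norm_eq_abs] using Real.abs_sin_le_one _⟩
  have h1 := ((Filter.tendsto_add_atTop_iff_nat 1).2 hlim).zero_mul_isBoundedUnder_le (hbdd 0)
  have h2 := hlim.zero_mul_isBoundedUnder_le (hbdd 1)
  have h3 := (h1.sub h2).const_mul (1 / X)
  simp only [sub_zero, mul_zero] at h3
  refine h3.congr fun N => ?_
  have hint : ∀ n : ℕ, IntervalIntegrable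
      (fun t => h t * Real.sin ((n : ℝ) * Real.pi * t / X)) MeasureTheory.volume 0 X := by
    intro n
    refine ContinuousOn.intervalIntegrable ?_
    rw [Set.uIcc_of_le hX.le]
    exact hh.mul (by fun_prop)
  simp only [add_zero]
  rw [← intervalIntegral.integral_mul_const, ← intervalIntegral.integral_mul_const,
    ← intervalIntegral.integral_sub ((hint _).mul_const _) ((hint _).mul_const _),
    ← intervalIntegral.integral_const_mul]
  simp_rw [← intervalIntegral.integral_const_mul, ← intervalIntegral.integral_mul_const]
  rw [← intervalIntegral.integral_finsetSum fun n _ =>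
    Continuous.intervalIntegrable (by fun_prop) _ _]
  refine intervalIntegral.integral_congr fun t ht => ?_
  rw [Set.uIcc_of_le hX.le] at ht
  have hcd := two_mul_cos_sub_cos_mul_sum_sin_mul_sin (Real.pi * t / X) (Real.pi * x / X) N
  have harg : ∀ (n : ℕ) (y : ℝ), (n : ℝ) * Real.pi * y / X = n * (Real.pi * y / X) := by
    intros; ring
  simp only [harg]
  have hsum : ∑ n ∈ Finset.Icc 1 N, 2 / X * (f t * Real.sin (n * (Real.pi * t / X))) *
        Real.sin (n * (Real.pi * x / X)) =
      2 / X * f t * ∑ n ∈ Finset.Icc 1 N, Real.sin (n * (Real.pi * t / X)) *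
        Real.sin (n * (Real.pi * x / X)) := by
    rw [Finset.mul_sum]
    exact Finset.sum_congr rfl fun _ _ => by ring
  rw [hsum, hfh t ht]
  linear_combination (-(h t / X)) * hcd

theorem integral_cos_int_mul_pi_div {X : ℝ} (hX : 0 < X) {m : ℤ} (hm : m ≠ 0) :
    ∫ t in (0:ℝ)..X, Real.cos (m * (Real.pi * t / X)) = 0 := by
  have hm' : (m : ℝ) ≠ 0 := Int.cast_ne_zero.2 hm
  have hc : (m : ℝ) * Real.pi / X ≠ 0 := by positivity
  have harg : ∀ t : ℝ, (m : ℝ) * (Real.pi * t / X) = m * Real.pi / X * t := by intro; ring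
  have hend : (m : ℝ) * Real.pi / X * X = m * Real.pi := by field_simp
  simp_rw [harg]
  rw [intervalIntegral.integral_comp_mul_left _ hc, integral_cos, hend]
  simp [Real.sin_int_mul_pi]

theorem integral_sin_mul_sin_nat_mul {X : ℝ} (hX : 0 < X) {n : ℕ} (hn : 1 ≤ n) :
    ∫ t in (0:ℝ)..X, Real.sin (Real.pi * t / X) * Real.sin ((n : ℝ) * Real.pi * t / X) =
      if n = 1 then X / 2 else 0 := by
  have hprod : ∀ t : ℝ, Real.sin (Real.pi * t / X) * Real.sin ((n : ℝ) * Real.pi * t / X) =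
      1 / 2 * (Real.cos (((n : ℤ) - 1 : ℤ) * (Real.pi * t / X)) -
        Real.cos (((n : ℤ) + 1 : ℤ) * (Real.pi * t / X))) := by
    intro t
    have e1 : (((n : ℤ) - 1 : ℤ) : ℝ) * (Real.pi * t / X) =
        n * Real.pi * t / X - Real.pi * t / X := by push_cast; ring
    have e2 : (((n : ℤ) + 1 : ℤ) : ℝ) * (Real.pi * t / X) =
        n * Real.pi * t / X + Real.pi * t / X := by push_cast; ring
    rw [e1, e2, Real.cos_sub, Real.cos_add]
    ring
  simp_rw [hprod]
  rw [intervalIntegral.integral_const_mul, intervalIntegral.integral_sub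
    (Continuous.intervalIntegrable (by fun_prop) _ _)
    (Continuous.intervalIntegrable (by fun_prop) _ _),
    integral_cos_int_mul_pi_div hX (m := (n : ℤ) + 1) (by omega)]
  split_ifs with h
  · subst h
    simp
    ring
  · rw [integral_cos_int_mul_pi_div hX (by omega)]
    simp

/-- A function differentiable at `x` and vanishing there is divisible by
`cos (π t / X) - cos (π x / X)` on `[0, X]`, with continuous quotient. -/
theorem exists_continuousOn_eq_cos_sub_cos_mul {X : ℝ} (hX : 0 < X) {f : ℝ → ℝ} {x : ℝ}
    (hf : Continuous f) (hfx : DifferentiableAt ℝ f x) (h0 : f x = 0) (hx1 : 0 < x) (hx2 : x < X) :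
    ∃ h : ℝ → ℝ, ContinuousOn h (Set.Icc 0 X) ∧ ∀ t ∈ Set.Icc 0 X,
      f t = (Real.cos (Real.pi * t / X) - Real.cos (Real.pi * x / X)) * h t := by
  set c : ℝ → ℝ := fun t => Real.cos (Real.pi * t / X) with hc
  have hcd : HasDerivAt c (-Real.sin (Real.pi * x / X) * (Real.pi * 1 / X)) x :=
    (((hasDerivAt_id x).const_mul Real.pi).div_const X).cos
  have hcc : Continuous c := by fun_prop
  have hmem : ∀ t ∈ Set.Icc 0 X, Real.pi * t / X ∈ Set.Icc 0 Real.pi := by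
    intro t ht
    refine ⟨by have := ht.1; positivity, ?_⟩
    rw [div_le_iff₀ hX]
    exact mul_le_mul_of_nonneg_left ht.2 Real.pi_pos.le
  have hne : ∀ t ∈ Set.Icc 0 X, dslope c x t ≠ 0 := by
    intro t ht
    rcases eq_or_ne t x with rfl | htx
    · rw [dslope_same, hcd.deriv]
      have hs : 0 < Real.sin (Real.pi * t / X) := by
        refine Real.sin_pos_of_pos_of_lt_pi (by positivity) ?_
        rw [div_lt_iff₀ hX]
        exact mul_lt_mul_of_pos_left hx2 Real.pi_pos
      have : 0 < Real.pi * 1 / X := by positivity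
      exact mul_ne_zero (neg_ne_zero.2 hs.ne') this.ne'
    · intro hzero
      have hct : (t - x) • dslope c x t = c t - c x := sub_smul_dslope c x t
      rw [hzero, smul_zero] at hct
      have hinj := Real.injOn_cos (hmem t ht) (hmem x ⟨hx1.le, hx2.le⟩) (sub_eq_zero.1 hct.symm)
      refine htx ?_
      field_simp at hinj
      exact hinj
  have hds : ∀ {g : ℝ → ℝ}, Continuous g → DifferentiableAt ℝ g x → Continuous (dslope g x) := by
    intro g hg hgx
    rw [← continuousOn_univ, continuousOn_dslope Filter.univ_mem]
    exact ⟨hg.continuousOn, hgx⟩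
  refine ⟨fun t => dslope f x t / dslope c x t,
    (hds hf hfx).continuousOn.div (hds hcc hcd.differentiableAt).continuousOn hne, ?_⟩
  intro t ht
  have hft : (t - x) • dslope f x t = f t - f x := sub_smul_dslope f x t
  have hct : (t - x) • dslope c x t = c t - c x := sub_smul_dslope c x t
  change f t = (c t - c x) * _
  rw [h0, sub_zero] at hft
  have := hne t ht
  rw [← hft, ← hct, smul_eq_mul, smul_eq_mul]
  field_simp

theorem stmt_17 (X : ℝ) (hX : 0 < X) (f : ℝ → ℝ) (hf : ContDiff ℝ 1 f)
    (x : ℝ) (hx1 : 0 < x) (hx2 : x < X) :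
    Filter.Tendsto
      (fun N : ℕ => ∑ n ∈ Finset.Icc 1 N,
        ((2 / X) * ∫ t in (0:ℝ)..X, f t * Real.sin ((n : ℝ) * Real.pi * t / X)) *
          Real.sin ((n : ℝ) * Real.pi * x / X))
      Filter.atTop (nhds (f x)) := by
  have hs : 0 < Real.sin (Real.pi * x / X) := by
    refine Real.sin_pos_of_pos_of_lt_pi (by positivity) ?_
    rw [div_lt_iff₀ hX]
    exact mul_lt_mul_of_pos_left hx2 Real.pi_pos
  -- Subtract a multiple of `sin (π t / X)`, whose sine series is itself, to make `f` vanish at `x`.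
  set C : ℝ := f x / Real.sin (Real.pi * x / X) with hC
  have hCx : C * Real.sin (Real.pi * x / X) = f x := div_mul_cancel₀ _ hs.ne'
  have hfc : Continuous f := hf.continuous
  have hfd : DifferentiableAt ℝ f x := hf.differentiable (by norm_num) x
  have hgc : Continuous fun t => f t - C * Real.sin (Real.pi * t / X) := by fun_prop
  obtain ⟨h, hh, hfh⟩ := exists_continuousOn_eq_cos_sub_cos_mul hX
    (f := fun t => f t - C * Real.sin (Real.pi * t / X)) hgc (by fun_prop)
    (by simp [hCx]) hx1 hx2
  have hlim := (tendsto_sineSeries_of_eq_cos_sub_cos_mul hX x hgc hh hfh).add_const (f x)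
  rw [zero_add] at hlim
  refine hlim.congr' ?_
  filter_upwards [Filter.eventually_ge_atTop 1] with N hN
  have hcoef : ∀ n ∈ Finset.Icc 1 N,
      (2 / X * ∫ t in (0:ℝ)..X, (f t - C * Real.sin (Real.pi * t / X)) *
        Real.sin ((n : ℝ) * Real.pi * t / X)) * Real.sin ((n : ℝ) * Real.pi * x / X) =
      (2 / X * ∫ t in (0:ℝ)..X, f t * Real.sin ((n : ℝ) * Real.pi * t / X)) *
        Real.sin ((n : ℝ) * Real.pi * x / X) - if n = 1 then f x else 0 := by
    intro n hn
    simp_rw [sub_mul, mul_assoc C]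
    rw [intervalIntegral.integral_sub (Continuous.intervalIntegrable (by fun_prop) _ _)
      (Continuous.intervalIntegrable (by fun_prop) _ _), intervalIntegral.integral_const_mul,
      integral_sin_mul_sin_nat_mul hX (Finset.mem_Icc.1 hn).1]
    split_ifs with h1
    · subst h1
      rw [← hCx, Nat.cast_one, one_mul]
      field_simp
    · ring
  rw [Finset.sum_congr rfl hcoef, Finset.sum_sub_distrib, Finset.sum_ite_eq', if_pos (by simp [hN])]
  ring
end

section
/- Let X > 0 and let f : ℝ → ℝ be continuously differentiable. Set a_0 = (1/X) · ∫_{0}^{X} f(t) dt and, for n ≥ 1, a_n = (2/X) · ∫_{0}^{X} f(t) · cos(n π t / X) dt. Then for every x with 0 ≤ x ≤ X, the series Σ_{n=1}^∞ a_n · cos(n π x / X) converges and a_0 + Σ_{n=1}^∞ a_n · cos(n π x / X) = f(x). -/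
open MeasureTheory Set Complex

/-- If `f` is continuous on an interval with a right derivative in `L²` and takes equal values at both endpoints, its
Fourier coefficients on the interval are summable. -/
theorem summable_fourierCoeffOn_of_hasDeriv_right {a b : ℝ} (hab : a < b) {f f' : ℝ → ℂ}
    (hf : ContinuousOn f (Icc a b)) (hfab : f a = f b)
    (hff' : ∀ x ∈ Ioo a b, HasDerivWithinAt f (f' x) (Ioi x) x)
    (hf' : MemLp f' 2 (volume.restrict (Ioc a b))) :
    Summable (fourierCoeffOn hab f) := by
  have hint : IntervalIntegrable f' volume a b :=
    (intervalIntegrable_iff_integrableOn_Ioc_of_le hab.le).2 (hf'.integrable (by norm_num))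
  have hsq : Summable fun n : ℤ => ‖fourierCoeffOn hab f' n‖ ^ 2 :=
    (hasSum_sq_fourierCoeffOn hab hf').summable
  have hinv : Summable fun n : ℤ => ((b - a) / (2 * Real.pi)) ^ 2 * (1 / (n : ℝ) ^ 2) :=
    (Real.summable_one_div_int_pow.2 one_lt_two).mul_left _
  refine Summable.of_norm_bounded_eventually (hinv.add hsq) ?_
  filter_upwards [(Set.finite_singleton (0 : ℤ)).compl_mem_cofinite] with n hn
  have hn : n ≠ 0 := by simpa using hn
  rw [fourierCoeffOn_of_hasDeriv_right hab hn (by rwa [uIcc_of_le hab.le])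
    (by rwa [min_eq_left hab.le, max_eq_right hab.le]) hint, hfab, sub_self, mul_zero, zero_sub]
  have hnorm : ‖1 / (-2 * (Real.pi : ℂ) * I * n) * -(((b : ℂ) - a) * fourierCoeffOn hab f' n)‖
      = (b - a) / (2 * Real.pi) * (1 / |(n : ℝ)|) * ‖fourierCoeffOn hab f' n‖ := by
    rw [← ofReal_sub]
    simp only [norm_mul, norm_div, norm_neg, norm_one, norm_I, norm_real, norm_intCast,
      Real.norm_eq_abs, abs_of_pos Real.pi_pos, abs_of_pos (sub_pos.2 hab), Complex.norm_ofNat]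
    have : |(n : ℝ)| ≠ 0 := by simpa using hn
    field_simp
  rw [hnorm]
  have h1 : 1 / (n : ℝ) ^ 2 = (1 / |(n : ℝ)|) ^ 2 := by rw [div_pow, sq_abs, one_pow]
  rw [h1]
  set u := (b - a) / (2 * Real.pi) * (1 / |(n : ℝ)|) with hu
  rw [← mul_pow, ← hu]
  nlinarith [sq_nonneg (u - ‖fourierCoeffOn hab f' n‖), sq_nonneg u,
    sq_nonneg ‖fourierCoeffOn hab f' n‖]

/-- Pointwise convergence of the Fourier series of a function on an interval with summable
coefficients and equal values at both endpoints. -/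
theorem hasSum_fourierCoeffOn_of_summable {a b : ℝ} (hab : a < b) {f : ℝ → ℂ}
    (hf : ContinuousOn f (Icc a b)) (hfab : f a = f b) (h : Summable (fourierCoeffOn hab f))
    {x : ℝ} (hx : x ∈ Icc a b) :
    HasSum (fun n : ℤ => fourierCoeffOn hab f n * fourier n (x : AddCircle (b - a))) (f x) := by
  obtain ⟨T, rfl⟩ : ∃ T, b = a + T := ⟨b - a, by ring⟩
  have hT : Fact (0 < T) := ⟨by linarith⟩
  rw [add_sub_cancel_left]
  let F : C(AddCircle T, ℂ) := ⟨AddCircle.liftIco T a f, AddCircle.liftIco_continuous hfab hf⟩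
  have hF : fourierCoeff F = fourierCoeffOn hab f :=
    funext fun n => fourierCoeff_liftIco_eq f n
  have hval : F (x : AddCircle T) = f x := by
    rcases hx.2.lt_or_eq with hlt | rfl
    · exact AddCircle.liftIco_coe_apply ⟨hx.1, hlt⟩
    · rw [AddCircle.coe_add_period, ← hfab]
      exact AddCircle.liftIco_coe_apply ⟨le_rfl, hab⟩
  have := has_pointwise_sum_fourier_series_of_summable (f := F) (by rwa [hF]) (x : AddCircle T)
  rw [hF, hval] at this
  simpa only [smul_eq_mul] using this

/-- The Fourier coefficients of the even extension of `f` from `[0, X]` to `[-X, X]` are its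
cosine coefficients. -/
theorem fourierCoeffOn_comp_abs {X : ℝ} (hX : -X < X) {f : ℝ → ℝ} (hf : Continuous f) (n : ℤ) :
    fourierCoeffOn hX (fun t => (f |t| : ℂ)) n =
      ((1 / X * ∫ t in (0 : ℝ)..X, f t * Real.cos (n * Real.pi * t / X) : ℝ) : ℂ) := by
  have hX0 : 0 < X := by linarith
  have hcont : Continuous fun t : ℝ => fourier (-n) (t : AddCircle (X - -X)) * (f |t| : ℂ) :=
    ((map_continuous (fourier (-n))).comp (AddCircle.continuous_mk' _)).mul (by fun_prop)
  simp only [fourierCoeffOn_eq_integral, smul_eq_mul]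
  rw [← intervalIntegral.integral_add_adjacent_intervals (b := 0)
      (hcont.intervalIntegrable _ _) (hcont.intervalIntegrable _ _),
    ← neg_zero, ← intervalIntegral.integral_comp_neg, neg_zero,
    ← intervalIntegral.integral_add
      (Continuous.intervalIntegrable (by exact hcont.comp continuous_neg) _ _)
      (hcont.intervalIntegrable _ _), ofReal_mul, ← intervalIntegral.integral_ofReal]
  have key : ∀ t ∈ uIcc 0 X, fourier (-n) ((-t : ℝ) : AddCircle (X - -X)) * (f |-t| : ℂ)
      + fourier (-n) (t : AddCircle (X - -X)) * (f |t| : ℂ)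
      = 2 * ((f t * Real.cos (n * Real.pi * t / X) : ℝ) : ℂ) := by
    intro t ht
    rw [uIcc_of_le hX0.le] at ht
    have hXc : (X : ℂ) ≠ 0 := by exact_mod_cast hX0.ne'
    rw [abs_neg, abs_of_nonneg ht.1, fourier_coe_apply, fourier_coe_apply, ← add_mul]
    push_cast
    rw [show (2 * Real.pi * I * -n * -t / (X - -X) : ℂ) = (n * Real.pi * t / X : ℂ) * I by
        field_simp; ring,
      show (2 * Real.pi * I * -n * t / (X - -X) : ℂ) = -(n * Real.pi * t / X : ℂ) * I by
        field_simp; ring, ← two_cos]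
    ring
  rw [intervalIntegral.integral_congr key, intervalIntegral.integral_const_mul, real_smul]
  push_cast
  have hXc : (X : ℂ) ≠ 0 := by exact_mod_cast hX0.ne'
  field_simp
  ring

/-- The right derivative of the even extension of a `C¹` function. -/
theorem hasDerivWithinAt_comp_abs_Ioi {f : ℝ → ℝ} (hf : Differentiable ℝ f) (x : ℝ) :
    HasDerivWithinAt (fun t => (f |t| : ℂ))
      ((if x < 0 then -deriv f (-x) else deriv f x : ℝ) : ℂ) (Ioi x) x := by
  refine HasDerivWithinAt.ofReal_comp (f := fun t => f |t|) ?_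
  split_ifs with h
  · have := ((hf (-x)).hasDerivAt.comp x (hasDerivAt_neg x))
    rw [mul_neg_one] at this
    refine (this.congr_of_eventuallyEq ?_).hasDerivWithinAt
    filter_upwards [Iio_mem_nhds h] with t ht
    rw [abs_of_neg (mem_Iio.1 ht), Function.comp_apply]
  · refine (hf x).hasDerivAt.hasDerivWithinAt.congr (fun t ht => ?_) ?_
    · rw [abs_of_nonneg ((not_lt.1 h).trans (le_of_lt ht))]
    · rw [abs_of_nonneg (not_lt.1 h)]

theorem stmt_18 (X : ℝ) (hX : 0 < X) (f : ℝ → ℝ) (hf : ContDiff ℝ 1 f)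
    (x : ℝ) (hx1 : 0 ≤ x) (hx2 : x ≤ X) :
    Filter.Tendsto
      (fun N : ℕ => (1 / X) * (∫ t in (0:ℝ)..X, f t) +
        ∑ n ∈ Finset.Icc 1 N,
          ((2 / X) * ∫ t in (0:ℝ)..X, f t * Real.cos ((n : ℝ) * Real.pi * t / X)) *
            Real.cos ((n : ℝ) * Real.pi * x / X))
      Filter.atTop (nhds (f x)) := by
  have hXX : -X < X := by linarith
  have hXc : (X : ℂ) ≠ 0 := by exact_mod_cast hX.ne'
  have hfc := hf.continuous
  have hdc : Continuous (deriv f) := hf.continuous_deriv le_rfl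
  have hcont : ContinuousOn (fun t => (f |t| : ℂ)) (Icc (-X) X) :=
    Continuous.continuousOn (by fun_prop)
  have hends : (f |-X| : ℂ) = f |X| := by rw [abs_neg]
  have hL2 : MemLp (fun x : ℝ => ((if x < 0 then -deriv f (-x) else deriv f x : ℝ) : ℂ)) 2
      (volume.restrict (Ioc (-X) X)) := by
    obtain ⟨C, hC⟩ := isCompact_Icc.exists_bound_of_continuousOn (s := Icc (-X) X) hdc.continuousOn
    refine MemLp.of_bound (Measurable.aestronglyMeasurable ?_) C ?_
    · exact measurable_ofReal.comp (Measurable.ite measurableSet_Iio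
        (hdc.comp continuous_neg).neg.measurable hdc.measurable)
    · filter_upwards [ae_restrict_mem measurableSet_Ioc] with t ht
      rw [norm_real]
      split_ifs
      · rw [norm_neg]
        exact hC _ ⟨by linarith [ht.2], by linarith [ht.1]⟩
      · exact hC _ ⟨ht.1.le, ht.2⟩
  have hsum := hasSum_fourierCoeffOn_of_summable hXX hcont hends
    (summable_fourierCoeffOn_of_hasDeriv_right hXX hcont hends
      (fun t _ => hasDerivWithinAt_comp_abs_Ioi (hf.differentiable one_ne_zero) t) hL2)
    (x := x) ⟨by linarith, hx2⟩
  simp only [fourierCoeffOn_comp_abs hXX hfc, abs_of_nonneg hx1] at hsum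
  have hcos : HasSum (fun n : ℕ =>
      ((2 / X) * ∫ t in (0:ℝ)..X, f t * Real.cos ((n : ℝ) * Real.pi * t / X)) *
        Real.cos ((n : ℝ) * Real.pi * x / X)) (f x + 1 / X * ∫ t in (0:ℝ)..X, f t) := by
    rw [← Complex.hasSum_ofReal]
    convert! hsum.nat_add_neg using 1
    · ext n
      have hneg : ∀ t : ℝ, Real.cos (((-(n : ℤ) : ℤ) : ℝ) * Real.pi * t / X)
          = Real.cos ((n : ℝ) * Real.pi * t / X) := fun t => by
        rw [← Real.cos_neg]
        push_cast
        ring_nf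
      simp only [hneg, Int.cast_natCast]
      rw [← mul_add, fourier_coe_apply, fourier_coe_apply]
      push_cast
      rw [show (2 * Real.pi * I * n * x / (X - -X) : ℂ) = (n * Real.pi * x / X : ℂ) * I by
          field_simp; ring,
        show (2 * Real.pi * I * -n * x / (X - -X) : ℂ) = -(n * Real.pi * x / X : ℂ) * I by
          field_simp; ring, ← two_cos]
      ring
    · simp
  have hlim := (hcos.tendsto_sum_nat.comp (Filter.tendsto_add_atTop_nat 1)).sub_const
    (1 / X * ∫ t in (0:ℝ)..X, f t)
  rw [add_sub_cancel_right] at hlim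
  refine hlim.congr fun N => ?_
  rw [Function.comp_apply, Finset.range_eq_Ico, Finset.sum_eq_sum_Ico_succ_bot (Nat.add_one_pos N),
    ← Finset.Ico_add_one_right_eq_Icc]
  simp only [Nat.cast_zero, zero_mul, zero_div, Real.cos_zero, mul_one, zero_add]
  ring
end
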